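/- Let p ∈ (1,∞), n ≥ 2, k ∈ {1,…,n−1}, −∞ < a_i < b_i < ∞ for i = 1,…,n−k, and l > 0. Define u_l on D_l = (−l,l)^k × ∏_{i=1}^{n−k}(a_i,b_i) by u_l(x,y) = (∏_{j=1}^k sin_p(π_p x_j / l)) · (∏_{i=1}^{n−k} sin_p(π_p (y_i − a_i)/(b_i − a_i))), extended by zero outside D_l. Then u_l ∈ W_0^{1,p}(ℝ^k × ∏_{i=1}^{n−k}(a_i,b_i)), ‖u_l‖_{L^p}^p = (2l/p)^k ∏_{i=1}^{n−k} (b_i−a_i)/p, and ‖|∇u_l|_{ℓ^p}‖_{L^p}^p = (π_p^p / (p' p^{n−k−1})) (2l/p)^k (∏_{i=1}^{n−k}(b_i−a_i)) (k/l^p + Σ_{i=1}^{n−k} (b_i−a_i)^{−p}), where p' = p/(p−1). Consequently, the infimum of ‖|∇u|_{ℓ^p}‖_{L^p}^p / ‖u‖_{L^p}^p over nonzero u ∈ W_0^{1,p}(D) is at most π_p^p (p−1)(k/l^p + Σ_{i=1}^{n−k}(b_i−a_i)^{−p}). -/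

import Mathlib

open MeasureTheory ENNReal Set Filter Topology

noncomputable section

/-- The `i`-th partial derivative of `u : ℝⁿ → ℝ`. -/
def pder {n : ℕ} (i : Fin n) (u : (Fin n → ℝ) → ℝ) (x : Fin n → ℝ) : ℝ :=
  fderiv ℝ u x (Pi.single i 1)

/-- `u` is a smooth function compactly supported in the open set `D`. -/
def IsTestFun {n : ℕ} (D : Set (Fin n → ℝ)) (u : (Fin n → ℝ) → ℝ) : Prop :=
  ContDiff ℝ (⊤ : ℕ∞) u ∧ HasCompactSupport u ∧ tsupport u ⊆ D

/-- The strip-like domain `ℝᵏ × ∏_{i ≥ k} (aᵢ, bᵢ)`, realized as a subset of `ℝⁿ`: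
the coordinates `i < k` are free, the coordinates `i ≥ k` are constrained to `(aᵢ, bᵢ)`. -/
def stripDomain (n k : ℕ) (a b : Fin n → ℝ) : Set (Fin n → ℝ) :=
  {x | ∀ i : Fin n, k ≤ (i : ℕ) → x i ∈ Set.Ioo (a i) (b i)}

/-- The ambient space `V = L^p(ℝⁿ; ℓ^p(ℝ^{n+1}))`, in which the Sobolev space `W^{1,p}_0`
is realized as the closure of the set of "jets" `(u, ∇u)` of test functions. -/
abbrev Vsp (n : ℕ) (p : ℝ≥0∞) [Fact (1 ≤ p)] :=
  Lp (PiLp p (fun _ : Fin (n + 1) => ℝ)) p (volume : Measure (Fin n → ℝ))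

/-- The "jet" `(u, ∂₁u, …, ∂ₙu)` of a function, valued in `ℓ^p(ℝ^{n+1})`. -/
def jet {n : ℕ} (p : ℝ≥0∞) (u : (Fin n → ℝ) → ℝ) (x : Fin n → ℝ) :
    PiLp p (fun _ : Fin (n + 1) => ℝ) :=
  (WithLp.equiv p (∀ _ : Fin (n + 1), ℝ)).symm (Fin.cons (u x) (fun i => pder i u x))

/-- `W^{1,p}_0(D)` realized as a closed subspace of `V`:
the closure of the subspace of jets of test functions supported in `D`.
The (subspace) norm of the jet of `u` is exactly
`(‖u‖_p^p + ‖ |∇u|_{ℓ^p} ‖_p^p)^{1/p}`, i.e., the `W^{1,p}`-norm of `u`. -/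
def W0sub {n : ℕ} (p : ℝ≥0∞) [Fact (1 ≤ p)] (D : Set (Fin n → ℝ)) : Submodule ℝ (Vsp n p) :=
  (Submodule.span ℝ {f : Vsp n p | ∃ u : (Fin n → ℝ) → ℝ, IsTestFun D u ∧
    (f : (Fin n → ℝ) → PiLp p (fun _ : Fin (n + 1) => ℝ)) =ᵐ[volume] jet p u}).topologicalClosure

instance W0sub.completeSpace {n : ℕ} (p : ℝ≥0∞) [Fact (1 ≤ p)] (D : Set (Fin n → ℝ)) :
    CompleteSpace (W0sub (n := n) p D) :=
  (Submodule.isClosed_topologicalClosure _).completeSpace_coe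

/-- Projection of a jet onto its zeroth (function) component. -/
def proj0 (n : ℕ) (p : ℝ≥0∞) [Fact (1 ≤ p)] : PiLp p (fun _ : Fin (n + 1) => ℝ) →L[ℝ] ℝ :=
  (ContinuousLinearMap.proj (0 : Fin (n + 1))).comp
    (PiLp.continuousLinearEquiv p ℝ (fun _ : Fin (n + 1) => ℝ)).toContinuousLinearMap

/-- Projection of a jet onto its gradient components, valued in `ℓ^p(ℝⁿ)`. -/
def projGrad (n : ℕ) (p : ℝ≥0∞) [Fact (1 ≤ p)] :
    PiLp p (fun _ : Fin (n + 1) => ℝ) →L[ℝ] PiLp p (fun _ : Fin n => ℝ) :=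
  ((PiLp.continuousLinearEquiv p ℝ (fun _ : Fin n => ℝ)).symm.toContinuousLinearMap).comp
    ((ContinuousLinearMap.pi fun i : Fin n => ContinuousLinearMap.proj (R := ℝ) i.succ).comp
      (PiLp.continuousLinearEquiv p ℝ (fun _ : Fin (n + 1) => ℝ)).toContinuousLinearMap)

/-- The canonical Sobolev embedding `I : W^{1,p}_0(D) → L^p(D)` (as a map into `L^p(ℝⁿ)`;
all functions in `W^{1,p}_0(D)` vanish a.e. outside `D`). -/
def SobolevEmb {n : ℕ} (p : ℝ≥0∞) [Fact (1 ≤ p)] (D : Set (Fin n → ℝ)) :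
    W0sub (n := n) p D →L[ℝ] Lp ℝ p (volume : Measure (Fin n → ℝ)) :=
  ((proj0 n p).compLpL p volume).comp (W0sub p D).subtypeL

/-- The gradient map `W^{1,p}_0(D) → L^p(D; ℓ^p(ℝⁿ))`, `u ↦ ∇u`. -/
def SobolevGrad {n : ℕ} (p : ℝ≥0∞) [Fact (1 ≤ p)] (D : Set (Fin n → ℝ)) :
    W0sub (n := n) p D →L[ℝ] Lp (PiLp p (fun _ : Fin n => ℝ)) p (volume : Measure (Fin n → ℝ)) :=
  ((projGrad n p).compLpL p volume).comp (W0sub p D).subtypeL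

/-- `π_p = 2 ∫₀¹ (1 - sᵖ)^{-1/p} ds`. -/
def piP (p : ℝ) : ℝ := 2 * ∫ s in (0 : ℝ)..1, (1 - s ^ p) ^ (-1 / p)

/-- The inverse of `t ↦ ∫₀ᵗ (1 - sᵖ)^{-1/p} ds` on `[0,1]`; this is `sin_p` on `[0, π_p/2]`. -/
def sinpHalf (p : ℝ) : ℝ → ℝ :=
  Function.invFunOn (fun t : ℝ => ∫ s in (0 : ℝ)..t, (1 - s ^ p) ^ (-1 / p)) (Set.Icc 0 1)

/-- `sin_p` on `[0, π_p]`, by reflection around `π_p/2`. -/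
def sinpBase (p t : ℝ) : ℝ :=
  if t ≤ piP p / 2 then sinpHalf p t else sinpHalf p (piP p - t)

/-- `sin_p` on `[-π_p, π_p]`, by odd reflection. -/
def sinpSym (p t : ℝ) : ℝ := if 0 ≤ t then sinpBase p t else -sinpBase p (-t)

/-- The generalized sine function `sin_p`, extended `2π_p`-periodically to all of `ℝ`. -/
def sinp (p t : ℝ) : ℝ :=
  sinpSym p (t - 2 * piP p * ⌊(t + piP p) / (2 * piP p)⌋)

/-- The generalized cosine function `cos_p = (sin_p)'`. -/
def cosp (p : ℝ) : ℝ → ℝ := deriv (sinp p)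

/-- The `m`-th entropy number of a bounded linear operator: the infimum of all `ε > 0` such
that the image of the closed unit ball can be covered by `2^{m-1}` balls of radius `ε`. -/
def entropyNumber {X Y : Type*} [NormedAddCommGroup X] [NormedSpace ℝ X]
    [NormedAddCommGroup Y] [NormedSpace ℝ Y] (m : ℕ) (T : X →L[ℝ] Y) : ℝ :=
  sInf {ε : ℝ | 0 < ε ∧ ∃ c : Fin (2 ^ (m - 1)) → Y,
    ∀ x : X, ‖x‖ ≤ 1 → ∃ j, ‖T x - c j‖ ≤ ε}

end

noncomputable section Stmt7

/-- The truncated box `D_l = (-l,l)^k × ∏_{i=1}^{n-k} (aᵢ,bᵢ)`. -/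
def boxDl (n k : ℕ) (a b : Fin n → ℝ) (l : ℝ) : Set (Fin n → ℝ) :=
  {x | ∀ i : Fin n, ((i : ℕ) < k → x i ∈ Set.Ioo (-l) l) ∧
    (k ≤ (i : ℕ) → x i ∈ Set.Ioo (a i) (b i))}

/-- The `i`-th factor of the extremal-type function `u_l`. -/
def ulFactor (n k : ℕ) (a b : Fin n → ℝ) (l p : ℝ) (i : Fin n) (x : Fin n → ℝ) : ℝ :=
  if (i : ℕ) < k then sinp p (piP p * x i / l)
  else sinp p (piP p * (x i - a i) / (b i - a i))

/-- The function `u_l`: the product of the factors on `D_l`, extended by zero. -/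
def ulFun (n k : ℕ) (a b : Fin n → ℝ) (l p : ℝ) : (Fin n → ℝ) → ℝ :=
  (boxDl n k a b l).indicator fun x => ∏ i : Fin n, ulFactor n k a b l p i x

/-- The `j`-th component of the (weak) gradient of `u_l`. -/
def ulGrad (n k : ℕ) (a b : Fin n → ℝ) (l p : ℝ) (j : Fin n) : (Fin n → ℝ) → ℝ :=
  (boxDl n k a b l).indicator fun x =>
    (if (j : ℕ) < k then piP p / l * cosp p (piP p * x j / l)
      else piP p / (b j - a j) * cosp p (piP p * (x j - a j) / (b j - a j))) *
      ∏ i ∈ Finset.univ.erase j, ulFactor n k a b l p i x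

/-! ### The generalized arcsine -/

/-- The function `t ↦ ∫₀ᵗ (1 - sᵖ)^{-1/p} ds`, whose inverse on `[0, 1]` is `sin_p`. -/
def arcsinp (p t : ℝ) : ℝ := ∫ s in (0 : ℝ)..t, (1 - s ^ p) ^ (-1 / p)

theorem arcsinp_zero (p : ℝ) : arcsinp p 0 = 0 := by simp [arcsinp]

theorem arcsinp_one (p : ℝ) : arcsinp p 1 = piP p / 2 := by
  simp only [arcsinp, piP]; ring

theorem intervalIntegrable_one_sub_rpow {p : ℝ} (hp : 1 < p) :
    IntervalIntegrable (fun s : ℝ => (1 - s ^ p) ^ (-1 / p)) volume 0 1 := by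
  have h1 : IntervalIntegrable (fun s : ℝ => (1 - s) ^ (-1 / p)) volume 0 1 := by
    have h : IntervalIntegrable (fun s : ℝ => s ^ (-1 / p)) volume 0 1 := by
      apply intervalIntegral.intervalIntegrable_rpow'
      rw [lt_div_iff₀ (by linarith)]; linarith
    simpa using (h.comp_sub_left 1).symm
  refine h1.mono_fun (by measurability : Measurable fun s : ℝ =>
    (1 - s ^ p) ^ (-1 / p)).aestronglyMeasurable ?_
  rw [uIoc_of_le zero_le_one]
  refine (ae_restrict_mem measurableSet_Ioc).mono fun s hs => ?_
  have hsp : s ^ p ≤ s := by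
    simpa using Real.rpow_le_rpow_of_exponent_ge hs.1 hs.2 hp.le
  rcases hs.2.eq_or_lt with rfl | h
  · simp
  have h0 : 0 < 1 - s := by linarith
  have h2 : (1 - s ^ p) ^ (-1 / p) ≤ (1 - s) ^ (-1 / p) :=
    Real.rpow_le_rpow_of_nonpos h0 (by linarith)
      (div_nonpos_of_nonpos_of_nonneg (by norm_num) (by linarith))
  dsimp only
  rw [Real.norm_of_nonneg (Real.rpow_nonneg (by linarith) _),
    Real.norm_of_nonneg (Real.rpow_nonneg h0.le _)]
  exact h2

theorem continuousOn_arcsinp {p : ℝ} (hp : 1 < p) : ContinuousOn (arcsinp p) (Icc 0 1) := by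
  have h := intervalIntegrable_one_sub_rpow hp
  rw [intervalIntegrable_iff_integrableOn_Icc_of_le zero_le_one] at h
  have h2 := intervalIntegral.continuousOn_primitive_interval (a := (0 : ℝ)) (b := 1) (μ := volume)
    (f := fun s : ℝ => (1 - s ^ p) ^ (-1 / p)) (by rwa [uIcc_of_le zero_le_one])
  rwa [uIcc_of_le zero_le_one] at h2

theorem one_sub_rpow_pos {p t : ℝ} (hp : 1 < p) (ht : t ∈ Ico (0 : ℝ) 1) : 0 < 1 - t ^ p := by
  have := Real.rpow_lt_one ht.1 ht.2 (by linarith : 0 < p)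
  linarith

theorem hasDerivAt_arcsinp {p t : ℝ} (hp : 1 < p) (ht : t ∈ Ioo (0 : ℝ) 1) :
    HasDerivAt (arcsinp p) ((1 - t ^ p) ^ (-1 / p)) t := by
  apply intervalIntegral.integral_hasDerivAt_right
  · exact (intervalIntegrable_one_sub_rpow hp).mono_set
      (by rw [uIcc_of_le ht.1.le, uIcc_of_le zero_le_one]; exact Icc_subset_Icc_right ht.2.le)
  · exact (by fun_prop : Measurable fun s : ℝ =>
      (1 - s ^ p) ^ (-1 / p)).stronglyMeasurable.stronglyMeasurableAtFilter
  · refine ContinuousAt.rpow_const ?_ (Or.inl (one_sub_rpow_pos hp ⟨ht.1.le, ht.2⟩).ne')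
    exact continuousAt_const.sub (continuousAt_id.rpow_const (Or.inl ht.1.ne'))

theorem sub_le_arcsinp_sub {p : ℝ} (hp : 1 < p) {x y : ℝ} (hx : x ∈ Icc (0 : ℝ) 1)
    (hy : y ∈ Icc (0 : ℝ) 1) (hxy : x ≤ y) : y - x ≤ arcsinp p y - arcsinp p x := by
  have := Convex.mul_sub_le_image_sub_of_le_deriv (convex_Icc (0 : ℝ) 1)
    (continuousOn_arcsinp hp) (C := 1) ?_ ?_ x hx y hy hxy
  · simpa using this
  · rw [interior_Icc]
    exact fun t ht => (hasDerivAt_arcsinp hp ht).differentiableAt.differentiableWithinAt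
  · rw [interior_Icc]
    intro t ht
    rw [(hasDerivAt_arcsinp hp ht).deriv]
    have h0 := one_sub_rpow_pos hp ⟨ht.1.le, ht.2⟩
    refine Real.one_le_rpow_of_pos_of_le_one_of_nonpos h0 ?_
      (div_nonpos_of_nonpos_of_nonneg (by norm_num) (by linarith))
    linarith [Real.rpow_nonneg ht.1.le p]

theorem piP_pos {p : ℝ} (hp : 1 < p) : 0 < piP p := by
  have := sub_le_arcsinp_sub hp (x := 0) (y := 1) (by simp) (by simp) zero_le_one
  rw [arcsinp_zero, arcsinp_one] at this
  linarith

theorem injOn_arcsinp {p : ℝ} (hp : 1 < p) : InjOn (arcsinp p) (Icc 0 1) := by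
  intro x hx y hy h
  rcases le_total x y with hxy | hxy
  · linarith [sub_le_arcsinp_sub hp hx hy hxy]
  · linarith [sub_le_arcsinp_sub hp hy hx hxy]

/-! ### `sin_p` on a quarter period -/

theorem exists_arcsinp_eq {p : ℝ} (hp : 1 < p) {t : ℝ} (ht : t ∈ Icc 0 (piP p / 2)) :
    ∃ s ∈ Icc (0 : ℝ) 1, arcsinp p s = t := by
  have h := intermediate_value_Icc zero_le_one (continuousOn_arcsinp hp)
  rw [arcsinp_zero, arcsinp_one] at h
  exact h ht

theorem sinpHalf_mem {p : ℝ} (hp : 1 < p) {t : ℝ} (ht : t ∈ Icc 0 (piP p / 2)) :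
    sinpHalf p t ∈ Icc (0 : ℝ) 1 :=
  Function.invFunOn_mem (exists_arcsinp_eq hp ht)

theorem arcsinp_sinpHalf {p : ℝ} (hp : 1 < p) {t : ℝ} (ht : t ∈ Icc 0 (piP p / 2)) :
    arcsinp p (sinpHalf p t) = t :=
  Function.invFunOn_eq (exists_arcsinp_eq hp ht)

theorem sinpHalf_arcsinp {p : ℝ} (hp : 1 < p) {s : ℝ} (hs : s ∈ Icc (0 : ℝ) 1) :
    sinpHalf p (arcsinp p s) = s :=
  (injOn_arcsinp hp).leftInvOn_invFunOn hs

theorem sinpHalf_zero {p : ℝ} (hp : 1 < p) : sinpHalf p 0 = 0 := by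
  simpa [arcsinp_zero] using sinpHalf_arcsinp hp (s := 0) (by simp)

theorem sinpHalf_half {p : ℝ} (hp : 1 < p) : sinpHalf p (piP p / 2) = 1 := by
  simpa [arcsinp_one] using sinpHalf_arcsinp hp (s := 1) (by simp)

theorem continuousOn_sinpHalf {p : ℝ} (hp : 1 < p) :
    ContinuousOn (sinpHalf p) (Icc 0 (piP p / 2)) := by
  refine (LipschitzOnWith.of_dist_le_mul (K := 1) fun x hx y hy => ?_).continuousOn
  have key := @sub_le_arcsinp_sub p hp (sinpHalf p x) (sinpHalf p y) (sinpHalf_mem hp hx)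
    (sinpHalf_mem hp hy)
  have key' := @sub_le_arcsinp_sub p hp (sinpHalf p y) (sinpHalf p x) (sinpHalf_mem hp hy)
    (sinpHalf_mem hp hx)
  rw [arcsinp_sinpHalf hp hx, arcsinp_sinpHalf hp hy] at key key'
  rw [Real.dist_eq, Real.dist_eq, NNReal.coe_one, one_mul]
  rcases le_total (sinpHalf p x) (sinpHalf p y) with h | h
  · rw [abs_sub_comm, abs_of_nonneg (sub_nonneg.2 h), abs_sub_comm]
    exact (key h).trans (le_abs_self _)
  · rw [abs_of_nonneg (sub_nonneg.2 h)]
    exact (key' h).trans (le_abs_self _)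

theorem sinpHalf_mem_Ioo {p : ℝ} (hp : 1 < p) {t : ℝ} (ht : t ∈ Ioo 0 (piP p / 2)) :
    sinpHalf p t ∈ Ioo (0 : ℝ) 1 := by
  have ht' := Ioo_subset_Icc_self ht
  have h := sinpHalf_mem hp ht'
  have h2 := arcsinp_sinpHalf hp ht'
  refine ⟨h.1.lt_of_ne fun h0 => ?_, h.2.lt_of_ne fun h0 => ?_⟩
  · rw [← h0, arcsinp_zero] at h2; exact ht.1.ne h2
  · rw [h0, arcsinp_one] at h2; exact ht.2.ne' h2

/-- The derivative of `sin_p` on the quarter period `[0, π_p / 2]`. -/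
def cospHalf (p t : ℝ) : ℝ := (1 - sinpHalf p t ^ p) ^ (1 / p)

theorem continuousOn_cospHalf {p : ℝ} (hp : 1 < p) :
    ContinuousOn (cospHalf p) (Icc 0 (piP p / 2)) :=
  ContinuousOn.rpow_const (continuousOn_const.sub ((continuousOn_sinpHalf hp).rpow_const
    fun _ _ => Or.inr (by linarith))) fun _ _ => Or.inr (one_div_nonneg.2 (by linarith))

theorem cospHalf_half {p : ℝ} (hp : 1 < p) : cospHalf p (piP p / 2) = 0 := by
  rw [cospHalf, sinpHalf_half hp, Real.one_rpow, sub_self, Real.zero_rpow]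
  exact (one_div_pos.2 (by linarith)).ne'

theorem sinpHalf_rpow_le_one {p : ℝ} (hp : 1 < p) {t : ℝ} (ht : t ∈ Icc 0 (piP p / 2)) :
    0 ≤ 1 - sinpHalf p t ^ p := by
  have h := sinpHalf_mem hp ht
  linarith [Real.rpow_le_one h.1 h.2 (by linarith : 0 ≤ p)]

theorem cospHalf_nonneg {p : ℝ} (hp : 1 < p) {t : ℝ} (ht : t ∈ Icc 0 (piP p / 2)) :
    0 ≤ cospHalf p t := Real.rpow_nonneg (sinpHalf_rpow_le_one hp ht) _

theorem cospHalf_rpow {p : ℝ} (hp : 1 < p) {t : ℝ} (ht : t ∈ Icc 0 (piP p / 2)) :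
    cospHalf p t ^ p = 1 - sinpHalf p t ^ p := by
  rw [cospHalf, ← Real.rpow_mul (sinpHalf_rpow_le_one hp ht),
    one_div_mul_cancel (by linarith), Real.rpow_one]

theorem hasDerivAt_sinpHalf {p : ℝ} (hp : 1 < p) {t : ℝ} (ht : t ∈ Ioo 0 (piP p / 2)) :
    HasDerivAt (sinpHalf p) (cospHalf p t) t := by
  have hs := sinpHalf_mem_Ioo hp ht
  have h0 := one_sub_rpow_pos hp ⟨hs.1.le, hs.2⟩
  have hnhds : Icc 0 (piP p / 2) ∈ 𝓝 t := Icc_mem_nhds ht.1 ht.2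
  have h := HasDerivAt.of_local_left_inverse ((continuousOn_sinpHalf hp).continuousAt hnhds)
    (hasDerivAt_arcsinp hp hs) (Real.rpow_pos_of_pos h0 _).ne'
    (by filter_upwards [hnhds] with y hy using arcsinp_sinpHalf hp hy)
  rwa [← Real.rpow_neg h0.le, neg_div, neg_neg] at h

theorem integral_cospHalf_sub {p : ℝ} (hp : 1 < p) :
    ∫ t in (0 : ℝ)..piP p / 2, (cospHalf p t ^ p - (p - 1) * sinpHalf p t ^ p) = 0 := by
  have hH : 0 ≤ piP p / 2 := by linarith [piP_pos hp]
  have hp0 : 0 < p := by linarith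
  have hcS : ContinuousOn (fun t => sinpHalf p t ^ p) (Icc 0 (piP p / 2)) :=
    (continuousOn_sinpHalf hp).rpow_const fun _ _ => Or.inr hp0.le
  have hcC : ContinuousOn (fun t => cospHalf p t ^ p) (Icc 0 (piP p / 2)) :=
    (continuousOn_cospHalf hp).rpow_const fun _ _ => Or.inr hp0.le
  rw [integral_eq_of_hasDerivAt_off_countable
    (fun t => sinpHalf p t * (1 - sinpHalf p t ^ p) ^ ((p - 1) / p)) _ countable_empty]
  · simp only [sinpHalf_half hp, sinpHalf_zero hp, Real.one_rpow, sub_self]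
    rw [Real.zero_rpow (div_pos (by linarith) hp0).ne']
    simp
  · rw [uIcc_of_le hH]
    exact (continuousOn_sinpHalf hp).mul ((continuousOn_const.sub hcS).rpow_const
      fun _ _ => Or.inr (div_nonneg (by linarith) hp0.le))
  · intro t ht
    rw [min_eq_left hH, max_eq_right hH, sdiff_empty] at ht
    have hs := sinpHalf_mem_Ioo hp ht
    have h0 := one_sub_rpow_pos hp ⟨hs.1.le, hs.2⟩
    have hS := hasDerivAt_sinpHalf hp ht
    have h1 := hS.mul (((hS.rpow_const (p := p) (Or.inl hs.1.ne')).const_sub 1).rpow_const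
      (p := (p - 1) / p) (Or.inl h0.ne'))
    refine h1.congr_deriv ?_
    have e1 : (p - 1) / p - 1 = -(1 / p) := by field_simp; ring
    have e2 : cospHalf p t * (1 - sinpHalf p t ^ p) ^ (-(1 / p)) = 1 := by
      rw [cospHalf, ← Real.rpow_add h0, add_neg_cancel, Real.rpow_zero]
    have e3 : cospHalf p t * (1 - sinpHalf p t ^ p) ^ ((p - 1) / p) = cospHalf p t ^ p := by
      rw [cospHalf_rpow hp (Ioo_subset_Icc_self ht), cospHalf, ← Real.rpow_add h0]
      rw [show 1 / p + (p - 1) / p = 1 by field_simp; ring, Real.rpow_one]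
    have e4 : sinpHalf p t * sinpHalf p t ^ (p - 1) = sinpHalf p t ^ p := by
      rw [← Real.rpow_one_add' hs.1.le (by linarith)]; congr 1; ring
    rw [e1, e3]
    have : sinpHalf p t * (-(cospHalf p t * p * sinpHalf p t ^ (p - 1)) * ((p - 1) / p) *
        (1 - sinpHalf p t ^ p) ^ (-(1 / p))) = -((p - 1) * (sinpHalf p t * sinpHalf p t ^ (p - 1)) *
        (cospHalf p t * (1 - sinpHalf p t ^ p) ^ (-(1 / p)))) := by
      field_simp
    rw [this, e2, e4]; ring
  · exact (by rw [uIcc_of_le hH]; exact hcC.sub (continuousOn_const.mul hcS) :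
      ContinuousOn _ _).intervalIntegrable

theorem integral_sinpHalf_rpow {p : ℝ} (hp : 1 < p) :
    ∫ t in (0 : ℝ)..piP p / 2, sinpHalf p t ^ p = piP p / 2 / p := by
  have hH : 0 ≤ piP p / 2 := by linarith [piP_pos hp]
  have h := integral_cospHalf_sub hp
  have h2 : ∫ t in (0 : ℝ)..piP p / 2, (cospHalf p t ^ p - (p - 1) * sinpHalf p t ^ p) =
      ∫ t in (0 : ℝ)..piP p / 2, (1 - p * sinpHalf p t ^ p) := by
    refine intervalIntegral.integral_congr fun t ht => ?_
    rw [uIcc_of_le hH] at ht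
    simp only [cospHalf_rpow hp ht]; ring
  have hcS : ContinuousOn (fun t => sinpHalf p t ^ p) (Icc 0 (piP p / 2)) :=
    (continuousOn_sinpHalf hp).rpow_const fun _ _ => Or.inr (by linarith)
  rw [h2, intervalIntegral.integral_sub intervalIntegrable_const
    ((by rw [uIcc_of_le hH]; exact continuousOn_const.mul hcS :
      ContinuousOn _ _).intervalIntegrable), intervalIntegral.integral_const_mul,
    intervalIntegral.integral_const, sub_zero, smul_eq_mul, mul_one] at h
  rw [_root_.eq_div_iff (by linarith)]; linarith

/-! ### `sin_p` on a full period -/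

theorem sinp_eq_sinpSym {p : ℝ} (hp : 1 < p) {t : ℝ} (ht : t ∈ Icc (-piP p) (piP p)) :
    sinp p t = sinpSym p t := by
  have hpi := piP_pos hp
  rcases ht.2.eq_or_lt with h | h
  · have h1 : (t + piP p) / (2 * piP p) = 1 := by rw [h]; field_simp; ring
    have h2 : t - 2 * piP p = -piP p := by rw [h]; ring
    have h3 : ¬ piP p ≤ piP p / 2 := by linarith
    have h4 : ¬ 0 ≤ -piP p := by linarith
    rw [sinp, h1, Int.floor_one, Int.cast_one, mul_one, h2, h]
    simp [sinpSym, sinpBase, h3, h4, hpi.le, sinpHalf_zero hp]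
  · have h1 : ⌊(t + piP p) / (2 * piP p)⌋ = 0 := by
      rw [Int.floor_eq_zero_iff]
      refine ⟨div_nonneg (by linarith [ht.1]) (by linarith), ?_⟩
      rw [div_lt_one (by linarith)]; linarith
    rw [sinp, h1]; simp

theorem sinp_eq_sinpHalf {p : ℝ} (hp : 1 < p) {t : ℝ} (ht : t ∈ Icc 0 (piP p / 2)) :
    sinp p t = sinpHalf p t := by
  have hpi := piP_pos hp
  rw [sinp_eq_sinpSym hp ⟨by linarith [ht.1], by linarith [ht.2]⟩, sinpSym, if_pos ht.1,
    sinpBase, if_pos ht.2]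

theorem sinp_eq_sinpHalf_sub {p : ℝ} (hp : 1 < p) {t : ℝ} (ht : t ∈ Icc (piP p / 2) (piP p)) :
    sinp p t = sinpHalf p (piP p - t) := by
  have hpi := piP_pos hp
  rcases ht.1.eq_or_lt with h | h
  · rw [sinp_eq_sinpHalf hp ⟨by linarith, h.ge⟩, ← h]; ring_nf
  · rw [sinp_eq_sinpSym hp ⟨by linarith, ht.2⟩, sinpSym, if_pos (by linarith),
      sinpBase, if_neg (by linarith)]

theorem sinp_zero {p : ℝ} (hp : 1 < p) : sinp p 0 = 0 := by
  rw [sinp_eq_sinpHalf hp ⟨le_rfl, by linarith [piP_pos hp]⟩, sinpHalf_zero hp]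

theorem sinp_piP {p : ℝ} (hp : 1 < p) : sinp p (piP p) = 0 := by
  rw [sinp_eq_sinpHalf_sub hp ⟨by linarith [piP_pos hp], le_rfl⟩, sub_self, sinpHalf_zero hp]

theorem sinp_neg {p : ℝ} (hp : 1 < p) {t : ℝ} (ht : t ∈ Icc (-piP p) (piP p)) :
    sinp p (-t) = -sinp p t := by
  have ht' : -t ∈ Icc (-piP p) (piP p) := ⟨by linarith [ht.2], by linarith [ht.1]⟩
  rcases lt_trichotomy t 0 with h | rfl | h
  · rw [sinp_eq_sinpSym hp ht, sinp_eq_sinpSym hp ht', sinpSym, sinpSym, if_pos (by linarith),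
      if_neg (by linarith), neg_neg]
  · simp [sinp_zero hp]
  · rw [sinp_eq_sinpSym hp ht, sinp_eq_sinpSym hp ht', sinpSym, sinpSym, if_neg (by linarith),
      if_pos (by linarith), neg_neg]

/-- An explicit formula for `cos_p` on `[-π_p, π_p]`. -/
def cospSym (p t : ℝ) : ℝ :=
  if |t| ≤ piP p / 2 then cospHalf p |t| else -cospHalf p (piP p - |t|)

theorem cospSym_neg (p t : ℝ) : cospSym p (-t) = cospSym p t := by
  simp [cospSym]

theorem cospSym_eq_cospHalf {p : ℝ} {t : ℝ} (ht : t ∈ Icc 0 (piP p / 2)) :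
    cospSym p t = cospHalf p t := by
  rw [cospSym, abs_of_nonneg ht.1, if_pos ht.2]

theorem cospSym_eq_neg_cospHalf_sub {p : ℝ} (hp : 1 < p) {t : ℝ}
    (ht : t ∈ Icc (piP p / 2) (piP p)) : cospSym p t = -cospHalf p (piP p - t) := by
  have hpi := piP_pos hp
  rcases ht.1.eq_or_lt with h | h
  · have : piP p - piP p / 2 = piP p / 2 := by ring
    rw [cospSym_eq_cospHalf ⟨by linarith, h.ge⟩, ← h, this, cospHalf_half hp, neg_zero]
  · rw [cospSym, abs_of_nonneg (by linarith), if_neg (by linarith)]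

theorem ContinuousOn.Icc_trans {f : ℝ → ℝ} {a b c : ℝ} (hab : a ≤ b) (hbc : b ≤ c)
    (h₁ : ContinuousOn f (Icc a b)) (h₂ : ContinuousOn f (Icc b c)) :
    ContinuousOn f (Icc a c) := by
  rw [← Icc_union_Icc_eq_Icc hab hbc]
  exact h₁.union_of_isClosed h₂ isClosed_Icc isClosed_Icc

theorem continuousOn_Icc_of_reflect {f f₀ : ℝ → ℝ} {a b c d e : ℝ} (hf₀ : ContinuousOn f₀ (Icc a b))
    (hc : e - d = a) (hd : e - c = b) (hf : ∀ t ∈ Icc c d, f t = f₀ (e - t)) :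
    ContinuousOn f (Icc c d) := by
  refine ContinuousOn.congr (f := fun t => f₀ (e - t)) ?_ hf
  exact hf₀.comp (by fun_prop) fun t ht => ⟨by linarith [ht.2], by linarith [ht.1]⟩

theorem continuousOn_sinp {p : ℝ} (hp : 1 < p) :
    ContinuousOn (sinp p) (Icc (-piP p) (piP p)) := by
  have hpi := piP_pos hp
  have h : ContinuousOn (sinp p) (Icc 0 (piP p)) := by
    refine ContinuousOn.Icc_trans (b := piP p / 2) (by linarith) (by linarith)
      ((continuousOn_sinpHalf hp).congr fun t ht => sinp_eq_sinpHalf hp ht) ?_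
    exact continuousOn_Icc_of_reflect (continuousOn_sinpHalf hp) (sub_self _) (by ring)
      fun t ht => sinp_eq_sinpHalf_sub hp ht
  refine ContinuousOn.Icc_trans (by linarith) hpi.le ?_ h
  refine continuousOn_Icc_of_reflect (e := 0) (f₀ := fun t => -sinp p t) h.neg (by simp) (by simp)
    fun t ht => ?_
  simp only [zero_sub]
  rw [sinp_neg hp ⟨ht.1, by linarith [ht.2]⟩, neg_neg]

theorem continuousOn_cospSym {p : ℝ} (hp : 1 < p) :
    ContinuousOn (cospSym p) (Icc (-piP p) (piP p)) := by
  have hpi := piP_pos hp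
  have h : ContinuousOn (cospSym p) (Icc 0 (piP p)) := by
    refine ContinuousOn.Icc_trans (b := piP p / 2) (by linarith) (by linarith)
      ((continuousOn_cospHalf hp).congr fun t ht => cospSym_eq_cospHalf ht) ?_
    exact continuousOn_Icc_of_reflect (continuousOn_cospHalf hp).neg (sub_self _) (by ring)
      fun t ht => cospSym_eq_neg_cospHalf_sub hp ht
  refine ContinuousOn.Icc_trans (by linarith) hpi.le ?_ h
  refine continuousOn_Icc_of_reflect (e := 0) h (by simp) (by simp) fun t ht => ?_
  rw [zero_sub, cospSym_neg]

theorem hasDerivAt_sinp_of_pos {p : ℝ} (hp : 1 < p) {t : ℝ} (ht : t ∈ Ioo 0 (piP p))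
    (ht' : t ≠ piP p / 2) : HasDerivAt (sinp p) (cospSym p t) t := by
  rcases ht'.lt_or_gt with h | h
  · have hm : t ∈ Ioo 0 (piP p / 2) := ⟨ht.1, h⟩
    rw [cospSym_eq_cospHalf (Ioo_subset_Icc_self hm)]
    refine (hasDerivAt_sinpHalf hp hm).congr_of_eventuallyEq ?_
    filter_upwards [Icc_mem_nhds hm.1 hm.2] with s hs using sinp_eq_sinpHalf hp hs
  · have hm : t ∈ Ioo (piP p / 2) (piP p) := ⟨h, ht.2⟩
    rw [cospSym_eq_neg_cospHalf_sub hp (Ioo_subset_Icc_self hm)]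
    refine HasDerivAt.congr_of_eventuallyEq (f := fun s => sinpHalf p (piP p - s)) ?_ ?_
    · exact (hasDerivAt_sinpHalf hp (t := piP p - t)
        ⟨by linarith [ht.2], by linarith⟩).comp_const_sub (piP p) t
    · filter_upwards [Icc_mem_nhds hm.1 hm.2] with s hs using sinp_eq_sinpHalf_sub hp hs

theorem hasDerivAt_sinp_of_ne {p : ℝ} (hp : 1 < p) {t : ℝ} (ht : t ∈ Ioo (-piP p) (piP p))
    (h0 : t ≠ 0) (h1 : t ≠ piP p / 2) (h2 : t ≠ -(piP p / 2)) :
    HasDerivAt (sinp p) (cospSym p t) t := by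
  rcases h0.lt_or_gt with h | h
  · have h3 := (hasDerivAt_sinp_of_pos hp (t := -t) ⟨by linarith, by linarith [ht.1]⟩
      (fun h => h2 (by linarith)))
    rw [← neg_neg t] at h3
    have h4 := ((neg_neg t ▸ h3).scomp t (hasDerivAt_neg t)).neg
    simp only [neg_neg, cospSym_neg, smul_eq_mul, neg_mul, one_mul] at h4
    refine h4.congr_of_eventuallyEq ?_
    filter_upwards [Icc_mem_nhds ht.1 ht.2] with s hs
    simp [sinp_neg hp hs]
  · exact hasDerivAt_sinp_of_pos hp ⟨h, ht.2⟩ h1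

theorem hasDerivAt_sinp {p : ℝ} (hp : 1 < p) {t : ℝ} (ht : t ∈ Ioo (-piP p) (piP p)) :
    HasDerivAt (sinp p) (cospSym p t) t := by
  have hpi := piP_pos hp
  have hc := continuousOn_cospSym hp
  have hint : ∀ x ∈ Icc (-piP p) (piP p), IntervalIntegrable (cospSym p) volume (-piP p) x :=
    fun x hx => (hc.mono (by rw [uIcc_of_le hx.1]; exact Icc_subset_Icc_right hx.2)
      ).intervalIntegrable
  have key : ∀ x ∈ Icc (-piP p) (piP p), sinp p x =
      (∫ s in (-piP p)..x, cospSym p s) + sinp p (-piP p) := by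
    intro x hx
    rw [integral_eq_of_hasDerivAt_off_countable (sinp p) (cospSym p)
      (s := {0, piP p / 2, -(piP p / 2)}) (Set.toFinite _).countable
      ((continuousOn_sinp hp).mono (by rw [uIcc_of_le hx.1]; exact Icc_subset_Icc_right hx.2))
      ?_ (hint x hx)]
    · ring
    · rintro y ⟨hy, hy'⟩
      rw [min_eq_left hx.1, max_eq_right hx.1] at hy
      simp only [mem_insert_iff, mem_singleton_iff, not_or] at hy'
      exact hasDerivAt_sinp_of_ne hp ⟨hy.1, hy.2.trans_le hx.2⟩ hy'.1 hy'.2.1 hy'.2.2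
  have hnhds : Icc (-piP p) (piP p) ∈ 𝓝 t := Icc_mem_nhds ht.1 ht.2
  refine HasDerivAt.congr_of_eventuallyEq ((intervalIntegral.integral_hasDerivAt_right
    (hint t (Ioo_subset_Icc_self ht)) ?_ (hc.continuousAt hnhds)).add_const (sinp p (-piP p))) ?_
  · exact hc.stronglyMeasurableAtFilter_nhdsWithin measurableSet_Icc t |>.filter_mono
      (by rw [nhdsWithin_eq_nhds.2 hnhds])
  · filter_upwards [hnhds] with x hx using key x hx

theorem cosp_eq_cospSym {p : ℝ} (hp : 1 < p) {t : ℝ} (ht : t ∈ Ioo (-piP p) (piP p)) :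
    cosp p t = cospSym p t := (hasDerivAt_sinp hp ht).deriv

theorem abs_cospSym_rpow {p : ℝ} (hp : 1 < p) {t : ℝ} (ht : t ∈ Icc (-piP p) (piP p)) :
    |cospSym p t| ^ p = 1 - |sinp p t| ^ p := by
  have hpi := piP_pos hp
  have aux : ∀ t ∈ Icc 0 (piP p), |cospSym p t| ^ p = 1 - |sinp p t| ^ p := by
    intro t ht
    rcases le_total t (piP p / 2) with h | h
    · have hm : t ∈ Icc 0 (piP p / 2) := ⟨ht.1, h⟩
      rw [cospSym_eq_cospHalf hm, sinp_eq_sinpHalf hp hm, abs_of_nonneg (cospHalf_nonneg hp hm),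
        abs_of_nonneg (sinpHalf_mem hp hm).1, cospHalf_rpow hp hm]
    · have hm : t ∈ Icc (piP p / 2) (piP p) := ⟨h, ht.2⟩
      have hm' : piP p - t ∈ Icc 0 (piP p / 2) := ⟨by linarith [ht.2], by linarith⟩
      rw [cospSym_eq_neg_cospHalf_sub hp hm, sinp_eq_sinpHalf_sub hp hm, abs_neg,
        abs_of_nonneg (cospHalf_nonneg hp hm'),
        abs_of_nonneg (sinpHalf_mem hp hm').1, cospHalf_rpow hp hm']
  rcases le_total 0 t with h | h
  · exact aux t ⟨h, ht.2⟩
  · have := aux (-t) ⟨by linarith, by linarith [ht.1]⟩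
    rwa [cospSym_neg, sinp_neg hp ht, abs_neg] at this

theorem continuousOn_abs_sinp_rpow {p : ℝ} (hp : 1 < p) :
    ContinuousOn (fun t => |sinp p t| ^ p) (Icc (-piP p) (piP p)) :=
  (continuousOn_sinp hp).abs.rpow_const fun _ _ => Or.inr (by linarith)

theorem integral_abs_sinp_rpow {p : ℝ} (hp : 1 < p) :
    ∫ t in (0 : ℝ)..piP p, |sinp p t| ^ p = piP p / p := by
  have hpi := piP_pos hp
  have hi : ∀ a ∈ Icc (-piP p) (piP p), ∀ b ∈ Icc (-piP p) (piP p),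
      IntervalIntegrable (fun t => |sinp p t| ^ p) volume a b := fun a ha b hb =>
    ((continuousOn_abs_sinp_rpow hp).mono (uIcc_subset_Icc ha hb)).intervalIntegrable
  have h1 : ∫ t in (0 : ℝ)..piP p / 2, |sinp p t| ^ p = piP p / 2 / p := by
    rw [← integral_sinpHalf_rpow hp]
    refine intervalIntegral.integral_congr fun t ht => ?_
    rw [uIcc_of_le (by linarith)] at ht
    simp only [sinp_eq_sinpHalf hp ht, abs_of_nonneg (sinpHalf_mem hp ht).1]
  have h2 : ∫ t in (piP p / 2)..piP p, |sinp p t| ^ p = piP p / 2 / p := by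
    have h := intervalIntegral.integral_comp_sub_left (fun t => sinpHalf p t ^ p) (piP p)
      (a := piP p / 2) (b := piP p)
    rw [sub_self, show piP p - piP p / 2 = piP p / 2 by ring, integral_sinpHalf_rpow hp] at h
    rw [← h]
    refine intervalIntegral.integral_congr fun t ht => ?_
    rw [uIcc_of_le (by linarith)] at ht
    simp only [sinp_eq_sinpHalf_sub hp ht, abs_of_nonneg (sinpHalf_mem hp
      (t := piP p - t) ⟨by linarith [ht.2], by linarith [ht.1]⟩).1]
  rw [← intervalIntegral.integral_add_adjacent_intervals (b := piP p / 2)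
    (hi _ ⟨by linarith, by linarith⟩ _ ⟨by linarith, by linarith⟩)
    (hi _ ⟨by linarith, by linarith⟩ _ ⟨by linarith, by linarith⟩), h1, h2]
  ring

theorem integral_abs_sinp_rpow_symm {p : ℝ} (hp : 1 < p) :
    ∫ t in (-piP p)..piP p, |sinp p t| ^ p = 2 * piP p / p := by
  have hpi := piP_pos hp
  have hi : ∀ a ∈ Icc (-piP p) (piP p), ∀ b ∈ Icc (-piP p) (piP p),
      IntervalIntegrable (fun t => |sinp p t| ^ p) volume a b := fun a ha b hb =>
    ((continuousOn_abs_sinp_rpow hp).mono (uIcc_subset_Icc ha hb)).intervalIntegrable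
  have h2 : ∫ t in (-piP p)..0, |sinp p t| ^ p = piP p / p := by
    have h := intervalIntegral.integral_comp_neg (fun t => |sinp p t| ^ p) (a := -piP p) (b := 0)
    rw [neg_neg, neg_zero, integral_abs_sinp_rpow hp] at h
    rw [← h]
    refine intervalIntegral.integral_congr fun t ht => ?_
    rw [uIcc_of_le (by linarith)] at ht
    simp only [sinp_neg hp ⟨ht.1, ht.2.trans hpi.le⟩, abs_neg]
  rw [← intervalIntegral.integral_add_adjacent_intervals (b := 0)
    (hi _ ⟨by linarith, by linarith⟩ _ ⟨by linarith, by linarith⟩)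
    (hi _ ⟨by linarith, by linarith⟩ _ ⟨by linarith, by linarith⟩), integral_abs_sinp_rpow hp, h2]
  ring

/-! ### Smooth approximation of a function vanishing at the endpoints of an interval -/

theorem tendsto_intervalIntegral_of_abs_le {F : ℕ → ℝ → ℝ} {G : ℝ → ℝ} {C : ℝ}
    (hF : ∀ m, Continuous (F m)) (hC : ∀ m x, |F m x| ≤ C)
    (hG : ∀ x, Tendsto (fun m => F m x) atTop (𝓝 (G x))) (a b : ℝ) :
    Tendsto (fun m => ∫ x in a..b, F m x) atTop (𝓝 (∫ x in a..b, G x)) := by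
  refine intervalIntegral.tendsto_integral_filter_of_dominated_convergence (fun _ => C) ?_ ?_
    intervalIntegrable_const ?_
  · exact Eventually.of_forall fun m => (hF m).aestronglyMeasurable
  · exact Eventually.of_forall fun m => Eventually.of_forall fun x _ => hC m x
  · exact Eventually.of_forall fun x _ => hG x

/-- A function on `ℝ` that is `C¹` on `[A, B]` and vanishes at the endpoints. -/
structure IsC1Vanishing (A B : ℝ) (f g : ℝ → ℝ) : Prop where
  lt : A < B
  continuousOn : ContinuousOn f (Icc A B)
  continuousOn_deriv : ContinuousOn g (Icc A B)
  hasDerivAt : ∀ x ∈ Ioo A B, HasDerivAt f (g x) x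
  left : f A = 0
  right : f B = 0

/-- A bump function supported in the interval of radius `r` around `c`, whose inner and outer
radii tend to `r` as `m` grows. -/
def wideBump (c : ℝ) {r : ℝ} (hr : 0 < r) (m : ℕ) : ContDiffBump c where
  rIn := r * (1 - 2 / (m + 3))
  rOut := r * (1 - 1 / (m + 3))
  rIn_pos := by
    have : (2 : ℝ) / (m + 3) < 1 := by
      rw [div_lt_one (by positivity)]
      linarith [m.cast_nonneg (α := ℝ)]
    exact mul_pos hr (by linarith)
  rIn_lt_rOut := by
    have : (1 : ℝ) / (m + 3) < 2 / (m + 3) := by gcongr; norm_num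
    exact mul_lt_mul_of_pos_left (by linarith) hr

theorem wideBump_rOut_lt (c : ℝ) {r : ℝ} (hr : 0 < r) (m : ℕ) : (wideBump c hr m).rOut < r := by
  have : (0 : ℝ) < 1 / (m + 3) := by positivity
  simp only [wideBump]; nlinarith

theorem wideBump_rOut_mono (c : ℝ) {r : ℝ} (hr : 0 < r) (m : ℕ) :
    (wideBump c hr 0).rOut ≤ (wideBump c hr m).rOut := by
  have : (1 : ℝ) / (m + 3) ≤ 1 / ((0 : ℕ) + 3) := by
    gcongr; positivity
  simp only [wideBump]
  exact mul_le_mul_of_nonneg_left (by linarith) hr.le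

theorem eventually_wideBump_eq_one (c : ℝ) {r : ℝ} (hr : 0 < r) {x : ℝ} (hx : |x - c| < r) :
    ∀ᶠ m : ℕ in atTop, wideBump c hr m x = 1 := by
  have h : Tendsto (fun m : ℕ => r * (1 - 2 / ((m : ℝ) + 3))) atTop (𝓝 (r * (1 - 0))) := by
    refine (tendsto_const_nhds.sub ?_).const_mul r
    exact tendsto_const_nhds.div_atTop
      (tendsto_atTop_add_const_right _ _ tendsto_natCast_atTop_atTop)
  rw [sub_zero, mul_one] at h
  filter_upwards [h.eventually (lt_mem_nhds hx)] with m hm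
  exact (wideBump c hr m).one_of_mem_closedBall (by
    rw [Metric.mem_closedBall, Real.dist_eq]; exact hm.le)

/-- The primitive of a smooth function of zero mean supported in `[c - s, c + s] ⊆ (A, B)`. -/
theorem primitive_smooth {A B c s : ℝ} {θ : ℝ → ℝ} (hθ : ContDiff ℝ (⊤ : ℕ∞) θ)
    (hA : A < c - s) (hB : c + s < B)
    (h0 : ∀ x, x ∉ Icc (c - s) (c + s) → θ x = 0)
    (hmean : ∫ x in A..B, θ x = 0) :
    ContDiff ℝ (⊤ : ℕ∞) (fun x => ∫ y in A..x, θ y) ∧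
    (∀ x, deriv (fun x => ∫ y in A..x, θ y) x = θ x) ∧
    ∀ x, x ∉ Icc (c - s) (c + s) → ∫ y in A..x, θ y = 0 := by
  have hd : ∀ x, HasDerivAt (fun x => ∫ y in A..x, θ y) (θ x) x := fun x =>
    intervalIntegral.integral_hasDerivAt_right (hθ.continuous.intervalIntegrable _ _)
      (hθ.continuous.stronglyMeasurableAtFilter _ _) hθ.continuous.continuousAt
  refine ⟨?_, fun x => (hd x).deriv, fun x hx => ?_⟩
  · rw [contDiff_infty_iff_deriv]
    refine ⟨fun x => (hd x).differentiableAt, ?_⟩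
    rwa [show deriv (fun x => ∫ y in A..x, θ y) = θ from funext fun x => (hd x).deriv]
  · rw [mem_Icc, not_and_or, not_le, not_le] at hx
    rcases hx with hx | hx
    · refine intervalIntegral.integral_zero_ae (Eventually.of_forall fun y hy => h0 y ?_)
      intro hy'
      have : y ≤ max A x := hy.2
      have : max A x < c - s := max_lt hA hx
      linarith [hy'.1]
    · have hz : ∫ y in B..x, θ y = 0 := by
        refine intervalIntegral.integral_zero_ae (Eventually.of_forall fun y hy => h0 y ?_)
        intro hy'
        have : min B x < y := hy.1
        have : c + s < min B x := lt_min hB hx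
        linarith [hy'.2]
      rw [← intervalIntegral.integral_add_adjacent_intervals
        (hθ.continuous.intervalIntegrable A B) (hθ.continuous.intervalIntegrable B x), hmean, hz,
        add_zero]

/-- A sequence of test functions on `(A, B)` converging pointwise and boundedly to `f`, along
with their derivatives. -/
structure IsTestApprox (A B : ℝ) (f g : ℝ → ℝ) (φ : ℕ → ℝ → ℝ) (C : ℝ) : Prop where
  contDiff : ∀ m, ContDiff ℝ (⊤ : ℕ∞) (φ m)
  hasCompactSupport : ∀ m, HasCompactSupport (φ m)
  tsupport_subset : ∀ m, tsupport (φ m) ⊆ Ioo A B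
  abs_le : ∀ m x, |φ m x| ≤ C
  abs_deriv_le : ∀ m x, |deriv (φ m) x| ≤ C
  tendsto : ∀ x, Tendsto (fun m => φ m x) atTop (𝓝 ((Ioo A B).indicator f x))
  tendsto_deriv : ∀ x, Tendsto (fun m => deriv (φ m) x) atTop (𝓝 ((Ioo A B).indicator g x))

/-- Smooth functions supported in `(A, B)` approximate a continuous function on `[A, B]` pointwise
and boundedly on the open interval. -/
theorem exists_smooth_approx_of_continuousOn {A B : ℝ} {g : ℝ → ℝ} (hAB : 0 < (B - A) / 2)
    (hg : ContinuousOn g (Icc A B)) :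
    ∃ (h : ℕ → ℝ → ℝ) (C : ℝ), (∀ m, ContDiff ℝ (⊤ : ℕ∞) (h m)) ∧
      (∀ m x, x ∉ Metric.closedBall ((A + B) / 2) (wideBump ((A + B) / 2) hAB m).rOut →
        h m x = 0) ∧
      (∀ m x, |h m x| ≤ C) ∧
      ∀ x, Tendsto (fun m => h m x) atTop (𝓝 ((Ioo A B).indicator g x)) := by
  obtain ⟨M, hM⟩ := isCompact_Icc.exists_bound_of_continuousOn hg
  choose q hq using fun m : ℕ => exists_polynomial_near_of_continuousOn A B g hg
    (1 / ((m : ℝ) + 1)) (by positivity)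
  set c := (A + B) / 2 with hc
  have hout : ∀ m x, x ∉ Metric.closedBall c (wideBump c hAB m).rOut → wideBump c hAB m x = 0 := by
    intro m x hx
    refine (wideBump c hAB m).zero_of_le_dist ?_
    rw [Metric.mem_closedBall, not_le] at hx
    exact hx.le
  have hsub : ∀ m, Metric.closedBall c (wideBump c hAB m).rOut ⊆ Ioo A B := by
    intro m x hx
    rw [Metric.mem_closedBall, Real.dist_eq, abs_le] at hx
    have := wideBump_rOut_lt c hAB m
    exact ⟨by linarith [hx.1], by linarith [hx.2]⟩
  refine ⟨fun m x => wideBump c hAB m x * (q m).eval x, |M| + 1, fun m => ?_, fun m x hx => ?_,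
    fun m x => ?_, fun x => ?_⟩
  · exact (wideBump c hAB m).contDiff.mul (by simpa using (q m).contDiff_aeval (𝕜 := ℝ) _)
  · simp only [hout m x hx, zero_mul]
  · by_cases hx : x ∈ Metric.closedBall c (wideBump c hAB m).rOut
    · have hx' := Ioo_subset_Icc_self (hsub m hx)
      have h1 := hq m x hx'
      have h2 : (1 : ℝ) / (m + 1) ≤ 1 := by
        rw [div_le_one (by positivity)]; linarith [m.cast_nonneg (α := ℝ)]
      have h3 := hM x hx'
      rw [Real.norm_eq_abs] at h3
      have h4 : |(q m).eval x| ≤ |M| + 1 := by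
        have := abs_add_le ((q m).eval x - g x) (g x)
        rw [sub_add_cancel] at this
        linarith [le_abs_self M]
      rw [abs_mul, abs_of_nonneg (wideBump c hAB m).nonneg]
      calc _ ≤ 1 * |(q m).eval x| :=
            mul_le_mul_of_nonneg_right (wideBump c hAB m).le_one (abs_nonneg _)
        _ ≤ _ := by rwa [one_mul]
    · simp only [hout m x hx, zero_mul, abs_zero]; positivity
  · by_cases hx : x ∈ Ioo A B
    · rw [indicator_of_mem hx]
      have hxr : |x - c| < (B - A) / 2 := by
        rw [abs_lt]; constructor <;> linarith [hx.1, hx.2]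
      have h1 : Tendsto (fun m => (q m).eval x) atTop (𝓝 (g x)) := by
        rw [tendsto_iff_dist_tendsto_zero]
        refine squeeze_zero (fun _ => dist_nonneg) (fun m => (hq m x
          (Ioo_subset_Icc_self hx)).le) tendsto_one_div_add_atTop_nhds_zero_nat
      refine h1.congr' ?_
      filter_upwards [eventually_wideBump_eq_one c hAB hxr] with m hm
      rw [hm, one_mul]
    · rw [indicator_of_notMem hx]
      refine tendsto_const_nhds.congr fun m => ?_
      simp only
      rw [hout m x (fun h => hx (hsub m h)), zero_mul]

theorem IsC1Vanishing.integral_indicator {A B : ℝ} {f g : ℝ → ℝ} (h : IsC1Vanishing A B f g)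
    {x : ℝ} (hx : x ∈ Icc A B) : ∫ y in A..x, (Ioo A B).indicator g y = f x := by
  rw [integral_eq_of_hasDerivAt_off_countable f _ countable_empty, h.left, sub_zero]
  · exact h.continuousOn.mono (by rw [uIcc_of_le hx.1]; exact Icc_subset_Icc_right hx.2)
  · intro y hy
    rw [min_eq_left hx.1, max_eq_right hx.1, sdiff_empty] at hy
    have hy' : y ∈ Ioo A B := ⟨hy.1, hy.2.trans_le hx.2⟩
    rw [indicator_of_mem hy']
    exact h.hasDerivAt y hy'
  · exact (((h.continuousOn_deriv.integrableOn_Icc).mono_set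
      Ioo_subset_Icc_self).integrable_indicator measurableSet_Ioo).intervalIntegrable

theorem IsC1Vanishing.exists_isTestApprox {A B : ℝ} {f g : ℝ → ℝ} (h : IsC1Vanishing A B f g) :
    ∃ φ C, IsTestApprox A B f g φ C := by
  have hAB := h.lt
  have hr : 0 < (B - A) / 2 := by linarith
  obtain ⟨u, C, hu, hu0, huC, hut⟩ := exists_smooth_approx_of_continuousOn hr h.continuousOn_deriv
  set c := (A + B) / 2 with hc
  set ψ : ℝ → ℝ := (wideBump c hr 0).normed volume with hψ
  have hψs : ContDiff ℝ (⊤ : ℕ∞) ψ := (wideBump c hr 0).contDiff_normed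
  obtain ⟨Cψ, hCψ⟩ := (wideBump c hr 0).hasCompactSupport_normed
    (μ := volume) |>.exists_bound_of_continuous hψs.continuous
  have hball : ∀ s, Metric.closedBall c s = Icc (c - s) (c + s) := fun s => Real.closedBall_eq_Icc
  have hψ0 : ∀ x, x ∉ Metric.closedBall c (wideBump c hr 0).rOut → ψ x = 0 := by
    intro x hx
    rw [← (wideBump c hr 0).tsupport_normed_eq (μ := volume)] at hx
    exact image_eq_zero_of_notMem_tsupport hx
  have hlo : ∀ m, A < c - (wideBump c hr m).rOut := fun m => by
    have := wideBump_rOut_lt c hr m; linarith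
  have hhi : ∀ m, c + (wideBump c hr m).rOut < B := fun m => by
    have := wideBump_rOut_lt c hr m; linarith
  have hψ1 : ∫ x in A..B, ψ x = 1 := by
    rw [← (wideBump c hr 0).integral_normed (μ := volume)]
    refine intervalIntegral.integral_eq_integral_of_support_subset fun x hx => ?_
    by_contra hx'
    refine hx (hψ0 x fun hm => hx' ?_)
    rw [hball] at hm
    exact ⟨(hlo 0).trans_le hm.1, hm.2.trans (hhi 0).le⟩
  set e : ℕ → ℝ := fun m => ∫ x in A..B, u m x with he
  have he0 : Tendsto e atTop (𝓝 0) := by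
    have := tendsto_intervalIntegral_of_abs_le (fun m => (hu m).continuous) huC hut A B
    rwa [h.integral_indicator (right_mem_Icc.2 hAB.le), h.right] at this
  have heC : ∀ m, |e m| ≤ C * (B - A) := by
    intro m
    have := intervalIntegral.norm_integral_le_of_norm_le_const (a := A) (b := B) (f := u m) (C := C)
      fun x _ => huC m x
    rwa [abs_of_nonneg (sub_nonneg.2 hAB.le)] at this
  set θ : ℕ → ℝ → ℝ := fun m x => u m x - e m * ψ x with hθ
  have hC0 : 0 ≤ C := (abs_nonneg _).trans (huC 0 0)
  have hCψ0 : 0 ≤ Cψ := (norm_nonneg _).trans (hCψ 0)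
  set C1 := C + C * (B - A) * Cψ with hC1
  have hC10 : 0 ≤ C1 := by
    have : 0 ≤ B - A := by linarith
    positivity
  have hθs : ∀ m, ContDiff ℝ (⊤ : ℕ∞) (θ m) := fun m => (hu m).sub (contDiff_const.mul hψs)
  have hθC : ∀ m x, |θ m x| ≤ C1 := by
    intro m x
    refine (abs_sub _ _).trans (add_le_add (huC m x) ?_)
    rw [abs_mul]
    exact mul_le_mul (heC m) (hCψ x) (abs_nonneg _) ((abs_nonneg _).trans (heC m))
  have hθ0 : ∀ m x, x ∉ Icc (c - (wideBump c hr m).rOut) (c + (wideBump c hr m).rOut) →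
      θ m x = 0 := by
    intro m x hx
    rw [← hball] at hx
    simp only [hθ, hu0 m x hx, hψ0 x fun hx' =>
      hx (Metric.closedBall_subset_closedBall (wideBump_rOut_mono c hr m) hx'), mul_zero, sub_zero]
  have hθt : ∀ x, Tendsto (fun m => θ m x) atTop (𝓝 ((Ioo A B).indicator g x)) := by
    intro x
    simpa using (hut x).sub (he0.mul_const (ψ x))
  have hmean : ∀ m, ∫ x in A..B, θ m x = 0 := by
    intro m
    simp only [hθ]
    rw [intervalIntegral.integral_sub (g := fun x => e m * ψ x)
      ((hu m).continuous.intervalIntegrable _ _)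
      ((continuous_const.mul hψs.continuous).intervalIntegrable _ _),
      intervalIntegral.integral_const_mul, hψ1, mul_one, sub_self]
  have key := fun m => primitive_smooth (hθs m) (hlo m) (hhi m) (hθ0 m) (hmean m)
  have hsupp : ∀ m, tsupport (fun x => ∫ y in A..x, θ m y) ⊆
      Icc (c - (wideBump c hr m).rOut) (c + (wideBump c hr m).rOut) := fun m =>
    closure_minimal (fun x hx => by_contra fun hx' => hx ((key m).2.2 x hx')) isClosed_Icc
  have hsub : ∀ m, Icc (c - (wideBump c hr m).rOut) (c + (wideBump c hr m).rOut) ⊆ Ioo A B :=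
    fun m => Icc_subset_Ioo (hlo m) (hhi m)
  have hBA : 0 ≤ C1 * (B - A) := mul_nonneg hC10 (by linarith)
  refine ⟨fun m x => ∫ y in A..x, θ m y, C1 + C1 * (B - A), fun m => (key m).1,
    fun m => HasCompactSupport.of_support_subset_isCompact isCompact_Icc
      (subset_closure.trans (hsupp m)), fun m => (hsupp m).trans (hsub m), fun m x => ?_,
    fun m x => ?_, fun x => ?_, fun x => ?_⟩
  · by_cases hx : x ∈ Icc (c - (wideBump c hr m).rOut) (c + (wideBump c hr m).rOut)
    · have hx' := hsub m hx
      have := intervalIntegral.norm_integral_le_of_norm_le_const (a := A) (b := x) (f := θ m)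
        (C := C1) fun x _ => hθC m x
      rw [abs_of_nonneg (by linarith [hx'.1]), Real.norm_eq_abs] at this
      have h2 : C1 * (x - A) ≤ C1 * (B - A) := mul_le_mul_of_nonneg_left (by linarith [hx'.2]) hC10
      linarith
    · simp only [(key m).2.2 x hx, abs_zero]; linarith
  · simp only [(key m).2.1 x]; linarith [hθC m x]
  · by_cases hx : x ∈ Ioo A B
    · have := tendsto_intervalIntegral_of_abs_le (fun m => (hθs m).continuous) hθC hθt A x
      rwa [h.integral_indicator (Ioo_subset_Icc_self hx), ← indicator_of_mem hx f] at this
    · rw [indicator_of_notMem hx]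
      exact tendsto_const_nhds.congr fun m => ((key m).2.2 x fun hx' => hx (hsub m hx')).symm
  · exact (hθt x).congr fun m => ((key m).2.1 x).symm

/-! ### Tensor products -/

/-- The tensor product `x ↦ ∏ᵢ Fᵢ(xᵢ)`. -/
def tensor {n : ℕ} (F : Fin n → ℝ → ℝ) (x : Fin n → ℝ) : ℝ := ∏ i, F i (x i)

theorem tensor_update {n : ℕ} (F : Fin n → ℝ → ℝ) (j : Fin n) (G : ℝ → ℝ) (x : Fin n → ℝ) :
    tensor (Function.update F j G) x = G (x j) * ∏ i ∈ Finset.univ.erase j, F i (x i) := by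
  rw [tensor, ← Finset.mul_prod_erase _ _ (Finset.mem_univ j), Function.update_self]
  congr 1
  refine Finset.prod_congr rfl fun i hi => ?_
  rw [Function.update_of_ne (Finset.ne_of_mem_erase hi)]

theorem abs_tensor_le {n : ℕ} {F : Fin n → ℝ → ℝ} {C : ℝ} (h : ∀ i x, |F i x| ≤ C)
    (x : Fin n → ℝ) : |tensor F x| ≤ C ^ n := by
  rw [tensor, Finset.abs_prod]
  calc _ ≤ ∏ _i : Fin n, C := Finset.prod_le_prod (fun _ _ => abs_nonneg _) fun i _ => h i _
    _ = C ^ n := by simp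

theorem contDiff_tensor {n : ℕ} {F : Fin n → ℝ → ℝ} (h : ∀ i, ContDiff ℝ (⊤ : ℕ∞) (F i)) :
    ContDiff ℝ (⊤ : ℕ∞) (tensor F) :=
  contDiff_prod fun i _ => (h i).comp (contDiff_apply ℝ ℝ i)

theorem pder_tensor {n : ℕ} {F : Fin n → ℝ → ℝ} (h : ∀ i, Differentiable ℝ (F i)) (j : Fin n)
    (x : Fin n → ℝ) :
    pder j (tensor F) x = tensor (Function.update F j (deriv (F j))) x := by
  have h1 : ∀ i ∈ (Finset.univ : Finset (Fin n)), HasFDerivAt (fun x : Fin n → ℝ => F i (x i))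
      (deriv (F i) (x i) • (ContinuousLinearMap.proj i : (Fin n → ℝ) →L[ℝ] ℝ)) x := fun i _ =>
    ((h i (x i)).hasDerivAt).comp_hasFDerivAt x (hasFDerivAt_apply i x)
  have h2 : HasFDerivAt (tensor F) _ x := HasFDerivAt.finsetProd h1
  rw [pder, h2.fderiv, tensor_update, sum_apply, Finset.sum_eq_single j]
  · simp [mul_comm]
  · intro i _ hij
    simp [hij]
  · simp

theorem support_tensor_subset {n : ℕ} (F : Fin n → ℝ → ℝ) :
    Function.support (tensor F) ⊆ univ.pi fun i => tsupport (F i) := by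
  intro x hx i _
  by_contra hi
  exact hx (Finset.prod_eq_zero (Finset.mem_univ i) (image_eq_zero_of_notMem_tsupport hi))

theorem isTestFun_tensor {n : ℕ} {F : Fin n → ℝ → ℝ} {D : Set (Fin n → ℝ)}
    (h : ∀ i, ContDiff ℝ (⊤ : ℕ∞) (F i)) (hc : ∀ i, HasCompactSupport (F i))
    (hD : (univ.pi fun i => tsupport (F i)) ⊆ D) : IsTestFun D (tensor F) := by
  have hK : IsCompact (univ.pi fun i => tsupport (F i)) := isCompact_univ_pi hc
  exact ⟨contDiff_tensor h, HasCompactSupport.of_support_subset_isCompact hK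
    (support_tensor_subset F), (closure_minimal (support_tensor_subset F) hK.isClosed).trans hD⟩

theorem tendsto_tensor {n : ℕ} {F : ℕ → Fin n → ℝ → ℝ} {G : Fin n → ℝ → ℝ}
    (h : ∀ i x, Tendsto (fun m => F m i x) atTop (𝓝 (G i x))) (x : Fin n → ℝ) :
    Tendsto (fun m => tensor (F m) x) atTop (𝓝 (tensor G x)) :=
  tendsto_finsetProd _ fun i _ => h i (x i)

/-! ### Convergence in `L^p` -/

/-- Bounded convergence in `L^p` on a set of finite measure. -/
theorem tendsto_toLp_of_bounded {α E : Type*} [MeasurableSpace α] {μ : Measure α}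
    [NormedAddCommGroup E] {p : ℝ≥0∞} [Fact (1 ≤ p)] (hp : p ≠ ∞) {F : ℕ → α → E} {G : α → E}
    {S : Set α} (hS : MeasurableSet S) (hμS : μ S ≠ ∞) {K : ℝ}
    (hF : ∀ m, AEStronglyMeasurable (F m) μ) (hK : ∀ m x, ‖F m x‖ ≤ K)
    (hFS : ∀ m, ∀ x ∉ S, F m x = 0) (hG : ∀ x, Tendsto (fun m => F m x) atTop (𝓝 (G x))) :
    ∃ (hF' : ∀ m, MemLp (F m) p μ) (hG' : MemLp G p μ),
      Tendsto (fun m => (hF' m).toLp (F m)) atTop (𝓝 (hG'.toLp G)) := by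
  have hp0 : p ≠ 0 := (zero_lt_one.trans_le (Fact.out : 1 ≤ p)).ne'
  have hpr : 0 < p.toReal := ENNReal.toReal_pos hp0 hp
  have hGK : ∀ x, ‖G x‖ ≤ K := fun x =>
    le_of_tendsto (hG x).norm (Eventually.of_forall fun m => hK m x)
  have hGS : ∀ x ∉ S, G x = 0 := fun x hx =>
    tendsto_nhds_unique (hG x) (tendsto_const_nhds.congr fun m => (hFS m x hx).symm)
  have hGm : AEStronglyMeasurable G μ :=
    aestronglyMeasurable_of_tendsto_ae atTop hF (Eventually.of_forall hG)
  have hmem : ∀ f : α → E, AEStronglyMeasurable f μ → (∀ x, ‖f x‖ ≤ K) → (∀ x ∉ S, f x = 0) →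
      MemLp f p μ := by
    intro f hf hfK hfS
    refine (memLp_indicator_const p hS K (Or.inr hμS)).mono hf (Eventually.of_forall fun x => ?_)
    by_cases hx : x ∈ S
    · rw [indicator_of_mem hx]; exact (hfK x).trans (le_abs_self K)
    · rw [hfS x hx, norm_zero]; exact norm_nonneg _
  have hF' : ∀ m, MemLp (F m) p μ := fun m => hmem _ (hF m) (hK m) (hFS m)
  have hG' : MemLp G p μ := hmem _ hGm hGK hGS
  refine ⟨hF', hG', ?_⟩
  rw [Lp.tendsto_Lp_iff_tendsto_eLpNorm'']
  have hlim : Tendsto (fun m => ∫⁻ x, ‖F m x - G x‖ₑ ^ p.toReal ∂μ) atTop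
      (𝓝 (∫⁻ _x, 0 ∂μ)) := by
    refine tendsto_lintegral_of_dominated_convergence'
      (S.indicator fun _ => ENNReal.ofReal (K + K) ^ p.toReal) (fun m => ?_) (fun m => ?_) ?_ ?_
    · exact ((hF m).sub hGm).enorm.pow_const _
    · refine Eventually.of_forall fun x => ?_
      by_cases hx : x ∈ S
      · simp only [indicator_of_mem hx]
        gcongr
        rw [← ofReal_norm]
        exact ENNReal.ofReal_le_ofReal ((norm_sub_le _ _).trans (add_le_add (hK m x) (hGK x)))
      · simp [hFS m x hx, hGS x hx, hpr]
    · rw [lintegral_indicator_const hS]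
      exact ENNReal.mul_ne_top (ENNReal.rpow_ne_top_of_nonneg hpr.le ENNReal.ofReal_ne_top) hμS
    · refine Eventually.of_forall fun x => ?_
      have h1 : Tendsto (fun m => ‖F m x - G x‖ₑ) atTop (𝓝 0) := by
        simpa using ((hG x).sub_const (G x)).enorm
      have h2 := (ENNReal.continuous_rpow_const (y := p.toReal)).continuousAt.tendsto.comp h1
      rwa [ENNReal.zero_rpow_of_pos hpr] at h2
  rw [lintegral_zero] at hlim
  have h2 := (ENNReal.continuous_rpow_const (y := 1 / p.toReal)).continuousAt.tendsto.comp hlim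
  rw [ENNReal.zero_rpow_of_pos (by positivity)] at h2
  refine h2.congr fun m => ?_
  rw [eLpNorm_eq_lintegral_rpow_enorm_toReal hp0 hp]
  rfl

/-! ### Tensor products of functions vanishing at the endpoints belong to `W₀^{1,p}` -/

/-- The vector in `ℓ^p(ℝ^{n+1})` assembled from a value and a gradient. -/
def mkJet {n : ℕ} (q : ℝ≥0∞) (u : ℝ) (v : Fin n → ℝ) : PiLp q (fun _ : Fin (n + 1) => ℝ) :=
  (WithLp.equiv q (∀ _ : Fin (n + 1), ℝ)).symm (Fin.cons u v)

theorem exists_mem_W0sub_tensor {n : ℕ} {q : ℝ≥0∞} [Fact (1 ≤ q)] (hq : q ≠ ∞)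
    {D : Set (Fin n → ℝ)} {A B : Fin n → ℝ} {f g : Fin n → ℝ → ℝ}
    (h : ∀ i, IsC1Vanishing (A i) (B i) (f i) (g i))
    (hD : (univ.pi fun i => Ioo (A i) (B i)) ⊆ D) :
    ∃ F : Vsp n q, F ∈ W0sub q D ∧
      (F : (Fin n → ℝ) → PiLp q (fun _ : Fin (n + 1) => ℝ)) =ᵐ[volume] fun x =>
        mkJet q (tensor (fun i => (Ioo (A i) (B i)).indicator (f i)) x) fun j =>
          tensor (Function.update (fun i => (Ioo (A i) (B i)).indicator (f i)) j
            ((Ioo (A j) (B j)).indicator (g j))) x := by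
  choose φ C hφ using fun i => (h i).exists_isTestApprox
  set M := ∑ i, |C i| with hM
  have hCM : ∀ i, C i ≤ M := fun i => (le_abs_self _).trans
    (Finset.single_le_sum (f := fun i => |C i|) (fun i _ => abs_nonneg _) (Finset.mem_univ i))
  have hM0 : 0 ≤ M := Finset.sum_nonneg fun i _ => abs_nonneg _
  set T : ℕ → (Fin n → ℝ) → ℝ := fun m => tensor fun i => φ i m with hT
  have hdiff : ∀ m i, Differentiable ℝ (φ i m) := fun m i =>
    ((hφ i).contDiff m).differentiable (by simp)
  have hpder : ∀ m j x, pder j (T m) x =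
      tensor (Function.update (fun i => φ i m) j (deriv (φ j m))) x := fun m j x =>
    pder_tensor (hdiff m) j x
  set e := (PiLp.continuousLinearEquiv q ℝ (fun _ : Fin (n + 1) => ℝ)).symm with he
  have hjet : ∀ m x, jet q (T m) x = e (Fin.cons (T m x) fun j => pder j (T m) x) :=
    fun m x => rfl
  have htest : ∀ m, IsTestFun D (T m) := fun m =>
    isTestFun_tensor (fun i => (hφ i).contDiff m) (fun i => (hφ i).hasCompactSupport m)
      ((pi_mono fun i _ => (hφ i).tsupport_subset m).trans hD)
  have hcont : ∀ m, Continuous (jet q (T m)) := by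
    intro m
    have hsm := (htest m).1
    refine e.continuous.comp (continuous_pi fun i => ?_)
    refine Fin.cases ?_ (fun j => ?_) i
    · simpa using hsm.continuous
    · simpa [pder] using (hsm.continuous_fderiv (by simp)).clm_apply continuous_const
  have hbound : ∀ m x, ‖jet q (T m) x‖ ≤
      ‖(e : (Fin (n + 1) → ℝ) →L[ℝ] PiLp q (fun _ : Fin (n + 1) => ℝ))‖ * M ^ n := by
    intro m x
    rw [hjet]
    refine ((e : (Fin (n + 1) → ℝ) →L[ℝ] PiLp q (fun _ : Fin (n + 1) => ℝ)).le_opNorm _).trans ?_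
    refine mul_le_mul_of_nonneg_left ?_ (norm_nonneg _)
    rw [pi_norm_le_iff_of_nonneg (pow_nonneg hM0 n)]
    refine Fin.cases ?_ fun j => ?_
    · rw [Fin.cons_zero]
      exact abs_tensor_le (fun i y => ((hφ i).abs_le m y).trans (hCM i)) x
    · rw [Fin.cons_succ, hpder]
      refine abs_tensor_le (fun i y => ?_) x
      rcases eq_or_ne i j with rfl | hij
      · rw [Function.update_self]; exact ((hφ i).abs_deriv_le m y).trans (hCM i)
      · rw [Function.update_of_ne hij]; exact ((hφ i).abs_le m y).trans (hCM i)
  have hzero : ∀ m, ∀ x ∉ (univ.pi fun i => Ioo (A i) (B i)), jet q (T m) x = 0 := by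
    intro m x hx
    simp only [mem_univ_pi, not_forall] at hx
    obtain ⟨i, hi⟩ := hx
    have hi' : x i ∉ tsupport (φ i m) := fun h' => hi ((hφ i).tsupport_subset m h')
    have h0 : φ i m (x i) = 0 := image_eq_zero_of_notMem_tsupport hi'
    have h1 : deriv (φ i m) (x i) = 0 :=
      Function.notMem_support.1 fun h' => hi' (support_deriv_subset h')
    rw [hjet, ← map_zero e]
    congr 1
    refine funext fun j => Fin.cases ?_ (fun j => ?_) j
    · rw [Fin.cons_zero]; exact Finset.prod_eq_zero (Finset.mem_univ i) h0
    · rw [Fin.cons_succ, hpder]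
      refine Finset.prod_eq_zero (Finset.mem_univ i) ?_
      rcases eq_or_ne i j with rfl | hij
      · rw [Function.update_self]; exact h1
      · rw [Function.update_of_ne hij]; exact h0
  have hlim : ∀ x, Tendsto (fun m => jet q (T m) x) atTop (𝓝 (mkJet q
      (tensor (fun i => (Ioo (A i) (B i)).indicator (f i)) x) fun j =>
        tensor (Function.update (fun i => (Ioo (A i) (B i)).indicator (f i)) j
          ((Ioo (A j) (B j)).indicator (g j))) x)) := by
    intro x
    refine (e.continuous.tendsto _).comp (tendsto_pi_nhds.2 (Fin.cases ?_ fun j => ?_))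
    · simp only [Fin.cons_zero]
      exact tendsto_tensor (fun i y => (hφ i).tendsto y) x
    · simp only [Fin.cons_succ, hpder]
      refine tendsto_tensor (fun i y => ?_) x
      rcases eq_or_ne i j with rfl | hij
      · simp only [Function.update_self]; exact (hφ i).tendsto_deriv y
      · simp only [Function.update_of_ne hij]; exact (hφ i).tendsto y
  have hvol : volume (univ.pi fun i => Ioo (A i) (B i)) ≠ ∞ := by
    rw [Real.volume_pi_Ioo]
    exact ENNReal.prod_ne_top fun i _ => ENNReal.ofReal_ne_top
  obtain ⟨hJ, hJ', hconv⟩ := tendsto_toLp_of_bounded hq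
    (MeasurableSet.univ_pi fun i => measurableSet_Ioo) hvol
    (fun m => (hcont m).aestronglyMeasurable) hbound hzero hlim
  refine ⟨hJ'.toLp _, ?_, hJ'.coeFn_toLp⟩
  refine mem_closure_of_tendsto hconv (Eventually.of_forall fun m => ?_)
  exact Submodule.subset_span ⟨T m, htest m, (hJ m).coeFn_toLp⟩

/-! ### Integrals of tensor products -/

theorem abs_tensor_rpow {n : ℕ} (F : Fin n → ℝ → ℝ) (p : ℝ) (x : Fin n → ℝ) :
    |tensor F x| ^ p = ∏ i, |F i (x i)| ^ p := by
  rw [tensor, Finset.abs_prod, Real.finsetProd_rpow _ _ fun i _ => abs_nonneg _]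

theorem integral_abs_tensor_rpow {n : ℕ} (F : Fin n → ℝ → ℝ) (p : ℝ) :
    ∫ x, |tensor F x| ^ p = ∏ i, ∫ t, |F i t| ^ p := by
  simp only [abs_tensor_rpow]
  exact integral_fintype_prod_volume_eq_prod fun i t => |F i t| ^ p

theorem integrable_abs_tensor_rpow {n : ℕ} {F : Fin n → ℝ → ℝ} {p : ℝ}
    (h : ∀ i, Integrable fun t => |F i t| ^ p) : Integrable fun x => |tensor F x| ^ p := by
  simp only [abs_tensor_rpow]
  exact Integrable.fintype_prod (f := fun i t => |F i t| ^ p) h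

theorem integral_sum_abs_tensor_update_rpow {n : ℕ} {F G : Fin n → ℝ → ℝ} {p : ℝ}
    (hF : ∀ i, Integrable fun t => |F i t| ^ p) (hG : ∀ i, Integrable fun t => |G i t| ^ p)
    {w : Fin n → ℝ} (hw : ∀ i, ∫ t, |G i t| ^ p = w i * ∫ t, |F i t| ^ p) :
    ∫ x, ∑ j, |tensor (Function.update F j (G j)) x| ^ p =
      (∑ j, w j) * ∏ i, ∫ t, |F i t| ^ p := by
  rw [integral_finsetSum, Finset.sum_mul]
  · refine Finset.sum_congr rfl fun j _ => ?_
    rw [integral_abs_tensor_rpow, ← Finset.mul_prod_erase _ _ (Finset.mem_univ j),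
      ← Finset.mul_prod_erase _ (fun i => ∫ t, |F i t| ^ p) (Finset.mem_univ j),
      Function.update_self, hw, mul_assoc]
    congr 2
    refine Finset.prod_congr rfl fun i hi => ?_
    rw [Function.update_of_ne (Finset.ne_of_mem_erase hi)]
  · refine fun j _ => integrable_abs_tensor_rpow fun i => ?_
    rcases eq_or_ne i j with rfl | hij
    · simpa only [Function.update_self] using hG i
    · simpa only [Function.update_of_ne hij] using hF i

theorem abs_indicator_rpow {S : Set ℝ} {f : ℝ → ℝ} {p : ℝ} (hp : 0 < p) :
    (fun t => |S.indicator f t| ^ p) = S.indicator fun t => |f t| ^ p := by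
  ext t
  by_cases ht : t ∈ S
  · simp [ht]
  · simp [ht, Real.zero_rpow hp.ne']

theorem integral_abs_indicator_rpow {A B p : ℝ} (hAB : A ≤ B) (hp : 0 < p) (f : ℝ → ℝ) :
    ∫ t, |(Ioo A B).indicator f t| ^ p = ∫ t in A..B, |f t| ^ p := by
  rw [abs_indicator_rpow hp, integral_indicator measurableSet_Ioo,
    intervalIntegral.integral_of_le hAB, integral_Ioc_eq_integral_Ioo]

theorem integrable_abs_indicator_rpow {A B p : ℝ} (hp : 0 < p) {f : ℝ → ℝ}
    (hf : ContinuousOn f (Icc A B)) : Integrable fun t => |(Ioo A B).indicator f t| ^ p := by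
  rw [abs_indicator_rpow hp]
  exact ((hf.abs.rpow_const fun _ _ => Or.inr hp.le).integrableOn_Icc.mono_set
    Ioo_subset_Icc_self).integrable_indicator measurableSet_Ioo

/-! ### Rescaled generalized sines -/

section Rescale

variable {p α a₀ c A B : ℝ}

theorem mapsTo_rescale (hc : 0 < c) (hA : c * (A - a₀) = α) (hB : c * (B - a₀) = piP p)
    {x : ℝ} (hx : x ∈ Icc A B) : c * (x - a₀) ∈ Icc α (piP p) := by
  rw [← hA, ← hB]
  exact ⟨by nlinarith [hx.1], by nlinarith [hx.2]⟩

theorem isC1Vanishing_rescale (hp : 1 < p) (hα : -piP p ≤ α) (hα' : α < piP p)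
    (hα0 : sinp p α = 0) (hc : 0 < c) (hA : c * (A - a₀) = α) (hB : c * (B - a₀) = piP p) :
    IsC1Vanishing A B (fun x => sinp p (c * (x - a₀)))
      (fun x => c * cospSym p (c * (x - a₀))) := by
  have hmaps : MapsTo (fun x => c * (x - a₀)) (Icc A B) (Icc (-piP p) (piP p)) := fun x hx =>
    Icc_subset_Icc_left hα (mapsTo_rescale hc hA hB hx)
  have hcont : ContinuousOn (fun x => c * (x - a₀)) (Icc A B) := by fun_prop
  refine ⟨?_, (continuousOn_sinp hp).comp hcont hmaps,
    continuousOn_const.mul ((continuousOn_cospSym hp).comp hcont hmaps), fun x hx => ?_, ?_, ?_⟩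
  · nlinarith
  · have hm : c * (x - a₀) ∈ Ioo (-piP p) (piP p) :=
      ⟨by nlinarith [hx.1], by nlinarith [hx.2]⟩
    have h1 : HasDerivAt (fun x => c * (x - a₀)) c x := by
      simpa using ((hasDerivAt_id x).sub_const a₀).const_mul c
    exact ((hasDerivAt_sinp hp hm).comp x h1).congr_deriv (mul_comm _ _)
  · simp only [hA, hα0]
  · simp only [hB, sinp_piP hp]

theorem integral_abs_sinp_rescale (hc : 0 < c) (hA : c * (A - a₀) = α)
    (hB : c * (B - a₀) = piP p)
    (hint : ∫ t in α..piP p, |sinp p t| ^ p = (piP p - α) / p) :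
    ∫ x in A..B, |sinp p (c * (x - a₀))| ^ p = (B - A) / p := by
  have h := intervalIntegral.integral_comp_mul_sub (fun t => |sinp p t| ^ p) hc.ne' (c * a₀)
    (a := A) (b := B)
  simp only [← mul_sub] at h
  rw [h, hA, hB, hint, ← hA, ← hB, smul_eq_mul]
  field_simp
  ring

theorem integral_abs_cosp_rescale (hp : 1 < p) (hα : -piP p ≤ α) (hα' : α < piP p) (hc : 0 < c)
    (hA : c * (A - a₀) = α) (hB : c * (B - a₀) = piP p)
    (hint : ∫ t in α..piP p, |sinp p t| ^ p = (piP p - α) / p) :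
    ∫ x in A..B, |c * cospSym p (c * (x - a₀))| ^ p =
      c ^ p * (p - 1) * ∫ x in A..B, |sinp p (c * (x - a₀))| ^ p := by
  have hAB : A ≤ B := by nlinarith
  have hmaps : MapsTo (fun x => c * (x - a₀)) (Icc A B) (Icc (-piP p) (piP p)) := fun x hx =>
    Icc_subset_Icc_left hα (mapsTo_rescale hc hA hB hx)
  have hcont : ContinuousOn (fun x => |sinp p (c * (x - a₀))| ^ p) (uIcc A B) := by
    rw [uIcc_of_le hAB]
    exact (continuousOn_abs_sinp_rpow hp).comp (by fun_prop) hmaps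
  have h1 : ∫ x in A..B, |c * cospSym p (c * (x - a₀))| ^ p =
      ∫ x in A..B, c ^ p * (1 - |sinp p (c * (x - a₀))| ^ p) := by
    refine intervalIntegral.integral_congr fun x hx => ?_
    rw [uIcc_of_le hAB] at hx
    rw [abs_mul, Real.mul_rpow (abs_nonneg _) (abs_nonneg _), abs_of_pos hc,
      abs_cospSym_rpow hp (hmaps hx)]
  rw [h1, intervalIntegral.integral_const_mul, intervalIntegral.integral_sub
    intervalIntegrable_const hcont.intervalIntegrable, integral_abs_sinp_rescale hc hA hB hint,
    intervalIntegral.integral_const, smul_eq_mul, mul_one]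
  have : p ≠ 0 := by linarith
  field_simp

end Rescale

/-! ### Norms of elements of `W₀^{1,p}` -/

theorem Lp_norm_rpow_eq_integral {α E : Type*} [MeasurableSpace α] {μ : Measure α}
    [NormedAddCommGroup E] {p : ℝ} (hp : 0 < p) (f : Lp E (ENNReal.ofReal p) μ) :
    ‖f‖ ^ p = ∫ x, ‖f x‖ ^ p ∂μ := by
  rw [Lp.norm_def, (Lp.memLp f).eLpNorm_eq_integral_rpow_norm (by simpa using hp)
    ENNReal.ofReal_ne_top, ENNReal.toReal_ofReal hp.le]
  have h : 0 ≤ ∫ x, ‖f x‖ ^ p ∂μ := integral_nonneg fun x => Real.rpow_nonneg (norm_nonneg _) _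
  rw [ENNReal.toReal_ofReal (Real.rpow_nonneg h _), ← Real.rpow_mul h,
    inv_mul_cancel₀ hp.ne', Real.rpow_one]

theorem norm_SobolevEmb_rpow {n : ℕ} {p : ℝ} (hp : 0 < p) [Fact (1 ≤ ENNReal.ofReal p)]
    {D : Set (Fin n → ℝ)} (F : W0sub (ENNReal.ofReal p) D) {u : (Fin n → ℝ) → ℝ}
    {v : Fin n → (Fin n → ℝ) → ℝ}
    (hF : (F : Vsp n (ENNReal.ofReal p)) =ᵐ[volume]
      fun x => mkJet (ENNReal.ofReal p) (u x) fun j => v j x) :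
    ‖SobolevEmb (ENNReal.ofReal p) D F‖ ^ p = ∫ x, |u x| ^ p := by
  rw [Lp_norm_rpow_eq_integral hp]
  refine integral_congr_ae ?_
  filter_upwards [hF, ContinuousLinearMap.coeFn_compLpL (μ := volume) (proj0 n (ENNReal.ofReal p))
    (F : Vsp n (ENNReal.ofReal p))] with x hx hx'
  have : (SobolevEmb (ENNReal.ofReal p) D F) x = u x := hx'.trans (by rw [hx]; rfl)
  rw [this, Real.norm_eq_abs]

theorem norm_SobolevGrad_rpow {n : ℕ} {p : ℝ} (hp : 0 < p) [Fact (1 ≤ ENNReal.ofReal p)]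
    {D : Set (Fin n → ℝ)} (F : W0sub (ENNReal.ofReal p) D) {u : (Fin n → ℝ) → ℝ}
    {v : Fin n → (Fin n → ℝ) → ℝ}
    (hF : (F : Vsp n (ENNReal.ofReal p)) =ᵐ[volume]
      fun x => mkJet (ENNReal.ofReal p) (u x) fun j => v j x) :
    ‖SobolevGrad (ENNReal.ofReal p) D F‖ ^ p = ∫ x, ∑ j, |v j x| ^ p := by
  rw [Lp_norm_rpow_eq_integral hp]
  refine integral_congr_ae ?_
  filter_upwards [hF, ContinuousLinearMap.coeFn_compLpL (μ := volume)
    (projGrad n (ENNReal.ofReal p)) (F : Vsp n (ENNReal.ofReal p))] with x hx hx'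
  have : (SobolevGrad (ENNReal.ofReal p) D F) x =
      WithLp.toLp (ENNReal.ofReal p) fun j => v j x := hx'.trans (by rw [hx]; rfl)
  have hpr : (ENNReal.ofReal p).toReal = p := ENNReal.toReal_ofReal hp.le
  rw [this, PiLp.norm_eq_sum (by rwa [hpr]), hpr, ← Real.rpow_mul
    (Finset.sum_nonneg fun i _ => Real.rpow_nonneg (norm_nonneg _) _),
    one_div_mul_cancel hp.ne', Real.rpow_one]
  rfl

/-! ### The function `u_l` -/

section Ul

variable {n k : ℕ} {a b : Fin n → ℝ} {l p : ℝ}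

/-- The left end point of the `i`-th side of `boxDl`. -/
def boxLeft (k : ℕ) (a : Fin n → ℝ) (l : ℝ) (i : Fin n) : ℝ := if (i : ℕ) < k then -l else a i

/-- The right end point of the `i`-th side of `boxDl`. -/
def boxRight (k : ℕ) (b : Fin n → ℝ) (l : ℝ) (i : Fin n) : ℝ := if (i : ℕ) < k then l else b i

/-- The zero of the `i`-th factor of `u_l` that is sent to the origin by the rescaling. -/
def ulOrigin (k : ℕ) (a : Fin n → ℝ) (i : Fin n) : ℝ := if (i : ℕ) < k then 0 else a i

/-- The frequency of the `i`-th factor of `u_l`. -/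
def ulFreq (k : ℕ) (a b : Fin n → ℝ) (l p : ℝ) (i : Fin n) : ℝ :=
  if (i : ℕ) < k then piP p / l else piP p / (b i - a i)

/-- The image of `boxLeft` under the rescaling. -/
def ulStart (k : ℕ) (p : ℝ) (i : Fin n) : ℝ := if (i : ℕ) < k then -piP p else 0

/-- The profile of `u_l` in the `i`-th coordinate. -/
def ulProfile (k : ℕ) (a b : Fin n → ℝ) (l p : ℝ) (i : Fin n) (t : ℝ) : ℝ :=
  sinp p (ulFreq k a b l p i * (t - ulOrigin k a i))

/-- The derivative of `ulProfile`. -/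
def ulProfileDeriv (k : ℕ) (a b : Fin n → ℝ) (l p : ℝ) (i : Fin n) (t : ℝ) : ℝ :=
  ulFreq k a b l p i * cospSym p (ulFreq k a b l p i * (t - ulOrigin k a i))

theorem ulFreq_pos (hp : 1 < p) (hab : ∀ i : Fin n, k ≤ (i : ℕ) → a i < b i) (hl : 0 < l)
    (i : Fin n) : 0 < ulFreq k a b l p i := by
  have := piP_pos hp
  unfold ulFreq
  split_ifs with h
  · positivity
  · have := sub_pos.2 (hab i (not_lt.1 h))
    positivity

theorem ulFreq_mul_left (hl : 0 < l) (i : Fin n) :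
    ulFreq k a b l p i * (boxLeft k a l i - ulOrigin k a i) = ulStart k p i := by
  unfold ulFreq boxLeft ulOrigin ulStart
  split_ifs with h
  · field_simp
    ring
  · simp

theorem ulFreq_mul_right (hab : ∀ i : Fin n, k ≤ (i : ℕ) → a i < b i) (hl : 0 < l) (i : Fin n) :
    ulFreq k a b l p i * (boxRight k b l i - ulOrigin k a i) = piP p := by
  unfold ulFreq boxRight ulOrigin
  split_ifs with h
  · field_simp
    ring
  · have := (sub_pos.2 (hab i (not_lt.1 h))).ne'
    field_simp

theorem neg_piP_le_ulStart (hp : 1 < p) (i : Fin n) : -piP p ≤ ulStart k p i := by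
  have := piP_pos hp
  unfold ulStart
  split_ifs <;> linarith

theorem ulStart_lt_piP (hp : 1 < p) (i : Fin n) : ulStart k p i < piP p := by
  have := piP_pos hp
  unfold ulStart
  split_ifs <;> linarith

theorem sinp_ulStart (hp : 1 < p) (i : Fin n) : sinp p (ulStart k p i) = 0 := by
  have := piP_pos hp
  unfold ulStart
  split_ifs
  · rw [sinp_neg hp ⟨by linarith, le_rfl⟩, sinp_piP hp, neg_zero]
  · exact sinp_zero hp

theorem integral_abs_sinp_rpow_ulStart (hp : 1 < p) (i : Fin n) :
    ∫ t in ulStart k p i..piP p, |sinp p t| ^ p = (piP p - ulStart k p i) / p := by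
  unfold ulStart
  split_ifs
  · rw [integral_abs_sinp_rpow_symm hp]
    ring
  · rw [integral_abs_sinp_rpow hp, sub_zero]

theorem isC1Vanishing_ulProfile (hp : 1 < p) (hab : ∀ i : Fin n, k ≤ (i : ℕ) → a i < b i)
    (hl : 0 < l) (i : Fin n) :
    IsC1Vanishing (boxLeft k a l i) (boxRight k b l i) (ulProfile k a b l p i)
      (ulProfileDeriv k a b l p i) :=
  isC1Vanishing_rescale hp (neg_piP_le_ulStart hp i) (ulStart_lt_piP hp i) (sinp_ulStart hp i)
    (ulFreq_pos hp hab hl i) (ulFreq_mul_left hl i) (ulFreq_mul_right hab hl i)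

theorem integral_abs_ulProfile_rpow (hp : 1 < p) (hab : ∀ i : Fin n, k ≤ (i : ℕ) → a i < b i)
    (hl : 0 < l) (i : Fin n) :
    ∫ t in boxLeft k a l i..boxRight k b l i, |ulProfile k a b l p i t| ^ p =
      (boxRight k b l i - boxLeft k a l i) / p :=
  integral_abs_sinp_rescale (ulFreq_pos hp hab hl i) (ulFreq_mul_left hl i)
    (ulFreq_mul_right hab hl i) (integral_abs_sinp_rpow_ulStart hp i)

theorem integral_abs_ulProfileDeriv_rpow (hp : 1 < p)
    (hab : ∀ i : Fin n, k ≤ (i : ℕ) → a i < b i) (hl : 0 < l) (i : Fin n) :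
    ∫ t in boxLeft k a l i..boxRight k b l i, |ulProfileDeriv k a b l p i t| ^ p =
      ulFreq k a b l p i ^ p * (p - 1) *
        ∫ t in boxLeft k a l i..boxRight k b l i, |ulProfile k a b l p i t| ^ p :=
  integral_abs_cosp_rescale hp (neg_piP_le_ulStart hp i) (ulStart_lt_piP hp i)
    (ulFreq_pos hp hab hl i) (ulFreq_mul_left hl i) (ulFreq_mul_right hab hl i)
    (integral_abs_sinp_rpow_ulStart hp i)

/-- `ulProfile` on the `i`-th side of `boxDl`, extended by zero. -/
def ulSide (k : ℕ) (a b : Fin n → ℝ) (l p : ℝ) (i : Fin n) : ℝ → ℝ :=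
  (Ioo (boxLeft k a l i) (boxRight k b l i)).indicator (ulProfile k a b l p i)

/-- `ulProfileDeriv` on the `i`-th side of `boxDl`, extended by zero. -/
def ulSideDeriv (k : ℕ) (a b : Fin n → ℝ) (l p : ℝ) (i : Fin n) : ℝ → ℝ :=
  (Ioo (boxLeft k a l i) (boxRight k b l i)).indicator (ulProfileDeriv k a b l p i)

theorem mem_boxDl {x : Fin n → ℝ} :
    x ∈ boxDl n k a b l ↔ ∀ i, x i ∈ Ioo (boxLeft k a l i) (boxRight k b l i) := by
  refine forall_congr' fun i => ?_
  unfold boxLeft boxRight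
  split_ifs with h
  · simp [h, not_le.2 h]
  · simp [h, not_lt.1 h]

theorem ulFactor_eq (i : Fin n) (x : Fin n → ℝ) :
    ulFactor n k a b l p i x = ulProfile k a b l p i (x i) := by
  unfold ulFactor ulProfile ulFreq ulOrigin
  split_ifs
  · rw [sub_zero, div_mul_eq_mul_div]
  · rw [div_mul_eq_mul_div]

theorem ulFun_eq_tensor : ulFun n k a b l p = tensor (ulSide k a b l p) := by
  ext x
  unfold ulFun tensor ulSide
  by_cases hx : x ∈ boxDl n k a b l
  · rw [indicator_of_mem hx]
    refine Finset.prod_congr rfl fun i _ => ?_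
    rw [indicator_of_mem (mem_boxDl.1 hx i), ulFactor_eq]
  · rw [indicator_of_notMem hx]
    obtain ⟨i, hi⟩ := not_forall.1 (mt mem_boxDl.2 hx)
    exact (Finset.prod_eq_zero (Finset.mem_univ i) (indicator_of_notMem hi _)).symm

theorem ulGrad_eq_tensor (hp : 1 < p) (hab : ∀ i : Fin n, k ≤ (i : ℕ) → a i < b i) (hl : 0 < l)
    (j : Fin n) :
    ulGrad n k a b l p j =
      tensor (Function.update (ulSide k a b l p) j (ulSideDeriv k a b l p j)) := by
  ext x
  rw [tensor_update]
  unfold ulGrad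
  by_cases hx : x ∈ boxDl n k a b l
  · have hx' := mem_boxDl.1 hx
    rw [indicator_of_mem hx]
    congr 1
    · rw [ulSideDeriv, indicator_of_mem (hx' j), ulProfileDeriv, ← cosp_eq_cospSym hp]
      · unfold ulFreq ulOrigin
        split_ifs
        · rw [sub_zero, div_mul_eq_mul_div (piP p) l (x j)]
        · rw [div_mul_eq_mul_div (piP p) (b j - a j) (x j - a j)]
      · have hc := ulFreq_pos hp hab hl j
        have hL := ulFreq_mul_left (a := a) (b := b) (k := k) (p := p) hl j
        have hR := ulFreq_mul_right (p := p) hab hl j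
        have hs := neg_piP_le_ulStart (k := k) hp j
        exact ⟨by nlinarith [(hx' j).1], by nlinarith [(hx' j).2]⟩
    · refine Finset.prod_congr rfl fun i _ => ?_
      rw [ulSide, indicator_of_mem (hx' i), ulFactor_eq]
  · rw [indicator_of_notMem hx]
    obtain ⟨i, hi⟩ := not_forall.1 (mt mem_boxDl.2 hx)
    rcases eq_or_ne i j with rfl | hij
    · rw [ulSideDeriv, indicator_of_notMem hi, zero_mul]
    · rw [Finset.prod_eq_zero (Finset.mem_erase.2 ⟨hij, Finset.mem_univ i⟩)
        (indicator_of_notMem hi _), mul_zero]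

theorem exists_mem_W0sub_ulFun (hp : 1 < p) (hab : ∀ i : Fin n, k ≤ (i : ℕ) → a i < b i)
    (hl : 0 < l) [Fact (1 ≤ ENNReal.ofReal p)] :
    ∃ F : Vsp n (ENNReal.ofReal p), F ∈ W0sub (ENNReal.ofReal p) (stripDomain n k a b) ∧
      F =ᵐ[volume] fun x => mkJet (ENNReal.ofReal p) (ulFun n k a b l p x)
        fun j => ulGrad n k a b l p j x := by
  have hsub : univ.pi (fun i => Ioo (boxLeft k a l i) (boxRight k b l i)) ⊆
      stripDomain n k a b := by
    intro x hx i hi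
    have := hx i (mem_univ i)
    simpa only [boxLeft, boxRight, if_neg (not_lt.2 hi)] using this
  obtain ⟨F, hF, hF'⟩ := exists_mem_W0sub_tensor (q := ENNReal.ofReal p) ENNReal.ofReal_ne_top
    (isC1Vanishing_ulProfile hp hab hl) hsub
  refine ⟨F, hF, ?_⟩
  simp only [ulFun_eq_tensor, ulGrad_eq_tensor hp hab hl]
  exact hF'

theorem prod_ite_lt (hk : k ≤ n) (r : ℝ) (f : Fin n → ℝ) :
    ∏ i : Fin n, (if (i : ℕ) < k then r else f i) =
      r ^ k * ∏ i ∈ Finset.univ.filter (fun i : Fin n => k ≤ (i : ℕ)), f i := by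
  rw [Finset.prod_ite, Finset.prod_const, Fin.card_filter_val_lt, min_eq_right hk]
  simp only [not_lt]

theorem sum_ite_lt (hk : k ≤ n) (r : ℝ) (f : Fin n → ℝ) :
    ∑ i : Fin n, (if (i : ℕ) < k then r else f i) =
      k * r + ∑ i ∈ Finset.univ.filter (fun i : Fin n => k ≤ (i : ℕ)), f i := by
  rw [Finset.sum_ite, Finset.sum_const, Fin.card_filter_val_lt, min_eq_right hk, nsmul_eq_mul]
  simp only [not_lt]

theorem integral_abs_ulSide_rpow (hp : 1 < p) (hab : ∀ i : Fin n, k ≤ (i : ℕ) → a i < b i)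
    (hl : 0 < l) (i : Fin n) :
    ∫ t, |ulSide k a b l p i t| ^ p = if (i : ℕ) < k then 2 * l / p else (b i - a i) / p := by
  have h := isC1Vanishing_ulProfile hp hab hl i
  rw [ulSide, integral_abs_indicator_rpow h.lt.le (by linarith),
    integral_abs_ulProfile_rpow hp hab hl]
  unfold boxLeft boxRight
  split_ifs
  · ring
  · rfl

theorem integral_abs_ulFun_rpow (hk : k ≤ n) (hp : 1 < p)
    (hab : ∀ i : Fin n, k ≤ (i : ℕ) → a i < b i) (hl : 0 < l) :
    ∫ x, |ulFun n k a b l p x| ^ p = (2 * l / p) ^ k *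
      ∏ i ∈ Finset.univ.filter (fun i : Fin n => k ≤ (i : ℕ)), ((b i - a i) / p) := by
  rw [ulFun_eq_tensor, integral_abs_tensor_rpow]
  simp only [integral_abs_ulSide_rpow hp hab hl]
  exact prod_ite_lt hk _ _

theorem sum_ulFreq_rpow (hk : k ≤ n) (hp : 1 < p)
    (hab : ∀ i : Fin n, k ≤ (i : ℕ) → a i < b i) (hl : 0 < l) :
    ∑ i, ulFreq k a b l p i ^ p * (p - 1) = piP p ^ p * (p - 1) * ((k : ℝ) / l ^ p +
      ∑ i ∈ Finset.univ.filter (fun i : Fin n => k ≤ (i : ℕ)), (b i - a i) ^ (-p)) := by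
  have hπ := (piP_pos hp).le
  have h : ∀ i, ulFreq k a b l p i ^ p =
      piP p ^ p * if (i : ℕ) < k then 1 / l ^ p else (b i - a i) ^ (-p) := by
    intro i
    unfold ulFreq
    split_ifs with hi
    · rw [Real.div_rpow hπ hl.le, mul_one_div]
    · have := (sub_pos.2 (hab i (not_lt.1 hi))).le
      rw [Real.div_rpow hπ this, Real.rpow_neg this, div_eq_mul_inv]
  simp only [h]
  rw [← Finset.sum_mul, ← Finset.mul_sum, sum_ite_lt hk]
  ring

theorem integral_sum_abs_ulGrad_rpow (hk : k ≤ n) (hp : 1 < p)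
    (hab : ∀ i : Fin n, k ≤ (i : ℕ) → a i < b i) (hl : 0 < l) :
    ∫ x, ∑ j, |ulGrad n k a b l p j x| ^ p = (piP p ^ p * (p - 1) * ((k : ℝ) / l ^ p +
      ∑ i ∈ Finset.univ.filter (fun i : Fin n => k ≤ (i : ℕ)), (b i - a i) ^ (-p))) *
        ∫ x, |ulFun n k a b l p x| ^ p := by
  have hp0 : 0 < p := by linarith
  have h := isC1Vanishing_ulProfile hp hab hl
  rw [ulFun_eq_tensor, integral_abs_tensor_rpow, ← sum_ulFreq_rpow hk hp hab hl]
  simp only [ulGrad_eq_tensor hp hab hl]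
  refine integral_sum_abs_tensor_update_rpow
    (fun i => integrable_abs_indicator_rpow hp0 (h i).continuousOn)
    (fun i => integrable_abs_indicator_rpow hp0 (h i).continuousOn_deriv) fun i => ?_
  rw [integral_abs_indicator_rpow (h i).lt.le hp0,
    integral_abs_indicator_rpow (h i).lt.le hp0, integral_abs_ulProfileDeriv_rpow hp hab hl]

theorem integral_abs_ulFun_rpow_pos (hk : k ≤ n) (hp : 1 < p)
    (hab : ∀ i : Fin n, k ≤ (i : ℕ) → a i < b i) (hl : 0 < l) :
    0 < ∫ x, |ulFun n k a b l p x| ^ p := by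
  have hp0 : 0 < p := by linarith
  rw [integral_abs_ulFun_rpow hk hp hab hl]
  refine mul_pos (by positivity) (Finset.prod_pos fun i hi => ?_)
  exact div_pos (sub_pos.2 (hab i (Finset.mem_filter.1 hi).2)) hp0

end Ul

/-- The function `u_l` belongs to `W₀^{1,p}(D)` for the strip-like domain
`D = ℝᵏ × ∏_{i=1}^{n-k} (aᵢ,bᵢ)`, its `L^p`-norm and gradient `L^p`-norm are given by the
stated explicit formulas, and consequently the infimum of the Rayleigh quotient over
nonzero elements of `W₀^{1,p}(D)` is at most
`π_p^p (p-1) (k/l^p + ∑ (bᵢ-aᵢ)^{-p})`. -/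
theorem ul_mem_W0_and_norms
    (n k : ℕ) (hn : 2 ≤ n) (hk1 : 1 ≤ k) (hk : k < n) (p : ℝ) (hp : 1 < p)
    (a b : Fin n → ℝ) (hab : ∀ i : Fin n, k ≤ (i : ℕ) → a i < b i) (l : ℝ) (hl : 0 < l) :
    letI : Fact (1 ≤ ENNReal.ofReal p) := ⟨ENNReal.one_le_ofReal.mpr hp.le⟩
    -- `u_l ∈ W₀^{1,p}(D)`: the jet `(u_l, ∇u_l)` belongs to the closed subspace `W0sub`
    (∃ F : Vsp n (ENNReal.ofReal p), F ∈ W0sub (ENNReal.ofReal p) (stripDomain n k a b) ∧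
      (F : (Fin n → ℝ) → PiLp (ENNReal.ofReal p) (fun _ : Fin (n + 1) => ℝ)) =ᵐ[volume]
        fun x => (WithLp.equiv (ENNReal.ofReal p) (∀ _ : Fin (n + 1), ℝ)).symm
          (Fin.cons (ulFun n k a b l p x) (fun j => ulGrad n k a b l p j x))) ∧
    -- `‖u_l‖_{L^p}^p = (2l/p)^k ∏ (bᵢ-aᵢ)/p`
    (∫ x : Fin n → ℝ, |ulFun n k a b l p x| ^ p) =
      (2 * l / p) ^ k *
        ∏ i ∈ Finset.univ.filter (fun i : Fin n => k ≤ (i : ℕ)), ((b i - a i) / p) ∧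
    -- `‖ |∇u_l|_{ℓ^p} ‖_{L^p}^p = π_p^p/(p' pⁿ⁻ᵏ⁻¹) (2l/p)^k (∏(bᵢ-aᵢ)) (k/l^p + ∑(bᵢ-aᵢ)^{-p})`
    (∫ x : Fin n → ℝ, ∑ j : Fin n, |ulGrad n k a b l p j x| ^ p) =
      piP p ^ p / ((p / (p - 1)) * p ^ (n - k - 1)) * (2 * l / p) ^ k *
        (∏ i ∈ Finset.univ.filter (fun i : Fin n => k ≤ (i : ℕ)), (b i - a i)) *
        ((k : ℝ) / l ^ p +
          ∑ i ∈ Finset.univ.filter (fun i : Fin n => k ≤ (i : ℕ)), (b i - a i) ^ (-p)) ∧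
    -- consequence for the infimum of the Rayleigh quotient
    sInf {r : ℝ | ∃ u : W0sub (ENNReal.ofReal p) (stripDomain n k a b), u ≠ 0 ∧
        r = ‖SobolevGrad (ENNReal.ofReal p) (stripDomain n k a b) u‖ ^ p /
            ‖SobolevEmb (ENNReal.ofReal p) (stripDomain n k a b) u‖ ^ p} ≤
      piP p ^ p * (p - 1) *
        ((k : ℝ) / l ^ p +
          ∑ i ∈ Finset.univ.filter (fun i : Fin n => k ≤ (i : ℕ)), (b i - a i) ^ (-p)) := by
  have hp0 : 0 < p := by linarith
  have hFact : Fact (1 ≤ ENNReal.ofReal p) := ⟨ENNReal.one_le_ofReal.mpr hp.le⟩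
  obtain ⟨F, hF, hFu⟩ := exists_mem_W0sub_ulFun hp hab hl
  refine ⟨⟨F, hF, hFu⟩, integral_abs_ulFun_rpow hk.le hp hab hl, ?_, ?_⟩
  · rw [integral_sum_abs_ulGrad_rpow hk.le hp hab hl, integral_abs_ulFun_rpow hk.le hp hab hl,
      Finset.prod_div_distrib, Finset.prod_const, show Finset.card _ = n - k from ?_]
    · obtain ⟨m, hm⟩ : ∃ m, n - k = m + 1 := ⟨n - k - 1, by omega⟩
      rw [hm, Nat.add_sub_cancel, pow_succ]
      have : p - 1 ≠ 0 := by linarith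
      field_simp
    · have h := Finset.card_filter_add_card_filter_not (s := (Finset.univ : Finset (Fin n)))
        (fun i => (i : ℕ) < k)
      rw [Fin.card_filter_val_lt, min_eq_right hk.le, Finset.card_univ, Fintype.card_fin] at h
      simp only [not_lt] at h
      omega
  · have hpos := integral_abs_ulFun_rpow_pos hk.le hp hab hl
    have hE := norm_SobolevEmb_rpow hp0 ⟨F, hF⟩ hFu
    have hG := norm_SobolevGrad_rpow hp0 ⟨F, hF⟩ hFu
    refine csInf_le ⟨0, ?_⟩ ⟨⟨F, hF⟩, fun h0 => ?_, ?_⟩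
    · rintro r ⟨u, -, rfl⟩
      positivity
    · rw [h0, map_zero, norm_zero, Real.zero_rpow hp0.ne'] at hE
      exact hpos.ne hE
    · rw [hE, hG, integral_sum_abs_ulGrad_rpow hk.le hp hab hl, mul_div_cancel_right₀ _ hpos.ne']

end Stmt7
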